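/- Let n ≤ m be positive integers and let Ω_n(d₁,…,d_m) denote the family of all polynomial mappings F = (f₁,…,f_m) : ℂⁿ → ℂᵐ of fixed multi-degree (d₁,…,d_m), i.e., deg f_i = d_i for each i. Then any two general members of this family are topologically equivalent: there is a Zariski open dense subset of the parameter space of coefficients such that all mappings with coefficients in this subset are topologically equivalent to one another. -/

import Mathlib

open MvPolynomial

/-- A family of complex numbers is `ε`-relatively close if any two members differ by at most `ε`
times the absolute value of either of them. -/
def RelClose {S : Type*} (ε : ℝ) (c : S → ℂ) : Prop :=
  ∀ s t, ‖c s - c t‖ ≤ ε * ‖c t‖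

namespace RelClose

variable {S : Type*} {ε δ : ℝ} {c c' : S → ℂ}

theorem mono (h : RelClose ε c) (hle : ε ≤ δ) : RelClose δ c := fun s t =>
  (h s t).trans (by gcongr)

theorem const (hε : 0 ≤ ε) (a : ℂ) : RelClose ε (fun _ : S => a) := fun s t => by
  simp only [sub_self, norm_zero]; positivity

theorem eq_zero (h : RelClose ε c) {t : S} (ht : c t = 0) (s : S) : c s = 0 := by
  have := h s t
  rw [ht] at this
  simpa using this

theorem inv (h : RelClose ε c) : RelClose ε (fun s => (c s)⁻¹) := by
  intro s t
  by_cases ht : c t = 0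
  · simp [ht, h.eq_zero ht s]
  have hs : c s ≠ 0 := fun hs => ht (h.eq_zero hs t)
  rw [inv_sub_inv hs ht, norm_div, norm_mul, norm_inv, div_le_iff₀ (by positivity)]
  calc ‖c t - c s‖ ≤ ε * ‖c s‖ := h t s
    _ = _ := by field_simp

theorem mul (h : RelClose ε c) (h' : RelClose δ c') (hε : 0 ≤ ε) :
    RelClose ((1 + ε) * (1 + δ) - 1) (fun s => c s * c' s) := by
  intro s t
  have h1 := h s t
  have h2 := h' s t
  have e : c s * c' s - c t * c' t
      = (c s - c t) * (c' s - c' t) + c t * (c' s - c' t) + (c s - c t) * c' t := by ring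
  rw [e, norm_mul]
  refine (norm_add₃_le).trans ?_
  simp only [norm_mul]
  calc _ ≤ (ε * ‖c t‖) * (δ * ‖c' t‖) + ‖c t‖ * (δ * ‖c' t‖) + (ε * ‖c t‖) * ‖c' t‖ := by
        gcongr
    _ = _ := by ring

theorem pow (h : RelClose ε c) (hε : 0 ≤ ε) (n : ℕ) :
    RelClose ((1 + ε) ^ n - 1) (fun s => c s ^ n) := by
  induction n with
  | zero => simpa using const (S := S) le_rfl 1
  | succ n ih =>
    refine (((ih.mul h) (by linarith [one_le_pow₀ (n := n) (show 1 ≤ 1 + ε by linarith)])).mono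
      ?_)
    rw [pow_succ]; simp

theorem prod {ι : Type*} {F : Finset ι} {f : ι → S → ℂ} (hε : 0 ≤ ε)
    (h : ∀ i ∈ F, RelClose ε (f i)) :
    RelClose ((1 + ε) ^ F.card - 1) (fun s => ∏ i ∈ F, f i s) := by
  classical
  induction F using Finset.induction_on with
  | empty => simpa using const (S := S) le_rfl 1
  | insert a F ha ih =>
    have h1 := ih fun i hi => h i (Finset.mem_insert_of_mem hi)
    have h2 := h a (Finset.mem_insert_self _ _)
    simp only [Finset.prod_insert ha, Finset.card_insert_of_notMem ha]
    refine (h2.mul h1 hε).mono ?_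
    rw [pow_succ]; linarith

end RelClose

/-- For every `n` and `ε > 0`, sufficiently small `δ` satisfies `(1 + δ) ^ n - 1 ≤ ε`. -/
theorem exists_pos_one_add_pow_sub_one_le (n : ℕ) {ε : ℝ} (hε : 0 < ε) :
    ∃ δ : ℝ, 0 < δ ∧ (1 + δ) ^ n - 1 ≤ ε := by
  have hc : Filter.Tendsto (fun δ : ℝ => (1 + δ) ^ n - 1) (nhdsWithin 0 (Set.Ioi 0)) (nhds 0) := by
    have : Continuous (fun δ : ℝ => (1 + δ) ^ n - 1) := by fun_prop
    simpa using this.continuousWithinAt.tendsto (x := 0) (s := Set.Ioi 0)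
  have h1 := hc.eventually (eventually_le_nhds hε)
  obtain ⟨δ, h, h'⟩ := (h1.and self_mem_nhdsWithin).exists
  exact ⟨δ, h', h⟩

/-- The weighted sum of the absolute values of the coefficients of `∏ (X - r)` at `x ≥ 0` is at
most `∏ (x + ‖r‖)`. -/
theorem sum_norm_coeff_prod_X_sub_C_le (m : Multiset ℂ) {x : ℝ} (hx : 0 ≤ x) :
    ∑ k ∈ Finset.range (m.card + 1),
      ‖((m.map fun r => Polynomial.X - Polynomial.C r).prod).coeff k‖ * x ^ k
      ≤ (m.map fun r => x + ‖r‖).prod := by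
  have key : ∀ k, ‖((m.map fun r => Polynomial.X - Polynomial.C r).prod).coeff k‖
      ≤ ((m.map fun r => Polynomial.X + Polynomial.C ‖r‖).prod).coeff k := by
    induction m using Multiset.induction_on with
    | empty => intro k; simp only [Multiset.map_zero, Multiset.prod_zero, Polynomial.coeff_one]
               split_ifs <;> simp
    | cons a m ih =>
      intro k
      simp only [Multiset.map_cons, Multiset.prod_cons, sub_mul, add_mul, Polynomial.coeff_sub,
        Polynomial.coeff_add, Polynomial.coeff_C_mul]
      refine (norm_sub_le _ _).trans (add_le_add ?_ ?_)
      · cases k with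
        | zero => simp
        | succ k => simpa using ih k
      · rw [norm_mul]; gcongr; exact ih k
  have hdeg : ((m.map fun r => Polynomial.X + Polynomial.C ‖r‖).prod).natDegree < m.card + 1 := by
    have := Polynomial.natDegree_multiset_prod_X_sub_C_eq_card (m.map fun r => -‖r‖)
    simp only [Multiset.map_map, Function.comp_def, map_neg, sub_neg_eq_add,
      Multiset.card_map] at this
    rw [this]; omega
  calc _ ≤ ∑ k ∈ Finset.range (m.card + 1),
      ((m.map fun r => Polynomial.X + Polynomial.C ‖r‖).prod).coeff k * x ^ k := by
        gcongr with k; exact key k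
    _ = ((m.map fun r => Polynomial.X + Polynomial.C ‖r‖).prod).eval x :=
        (Polynomial.eval_eq_sum_range' hdeg x).symm
    _ = _ := by simp [Polynomial.eval_multiset_prod, Multiset.map_map]

open Polynomial in
/-- A monic complex polynomial evaluated through its roots. -/
theorem monic_eval_eq_prod_roots {f : ℂ[X]} (hf : f.Monic) (z : ℂ) :
    f.eval z = (f.roots.map fun r => z - r).prod := by
  conv_lhs => rw [(IsAlgClosed.splits f).eq_prod_roots_of_monic hf]
  simp [Polynomial.eval_multiset_prod, Multiset.map_map]

open Polynomial in
/-- The absolute value of a monic complex polynomial through its roots. -/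
theorem norm_monic_eval_eq_prod_roots {f : ℂ[X]} (hf : f.Monic) (z : ℂ) :
    ‖f.eval z‖ = (f.roots.map fun r => ‖z - r‖).prod := by
  have := map_multiset_prod (normHom : ℂ →*₀ ℝ) (f.roots.map fun r => z - r)
  rw [Multiset.map_map] at this
  rw [monic_eval_eq_prod_roots hf]
  exact this

open Polynomial in
/-- If the coefficients of `g` are close to those of the monic `f` relative to the coefficients of
`f`, then `f` is small at the roots of `g`, relative to `∏ (‖z‖ + ‖r‖)`. -/
theorem norm_eval_le_of_relClose {f g : ℂ[X]} (hf : f.Monic) (hg : g.natDegree = f.natDegree)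
    {ε : ℝ} (hε : 0 ≤ ε) (h : ∀ k, ‖f.coeff k - g.coeff k‖ ≤ ε * ‖f.coeff k‖) {z : ℂ}
    (hz : g.eval z = 0) :
    ‖f.eval z‖ ≤ ε * (f.roots.map fun r => ‖z‖ + ‖r‖).prod := by
  have hcard : f.roots.card = f.natDegree := (IsAlgClosed.splits f).natDegree_eq_card_roots.symm
  have h1 := sum_norm_coeff_prod_X_sub_C_le f.roots (norm_nonneg z)
  rw [← (IsAlgClosed.splits f).eq_prod_roots_of_monic hf, hcard] at h1
  have e : f.eval z = ∑ k ∈ Finset.range (f.natDegree + 1), (f.coeff k - g.coeff k) * z ^ k := by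
    simp only [sub_mul, Finset.sum_sub_distrib]
    rw [← Polynomial.eval_eq_sum_range' (Nat.lt_succ_self _),
      ← Polynomial.eval_eq_sum_range' (by omega), hz, sub_zero]
  calc ‖f.eval z‖ ≤ ∑ k ∈ Finset.range (f.natDegree + 1), ε * (‖f.coeff k‖ * ‖z‖ ^ k) := by
        rw [e]
        refine norm_sum_le_of_le _ fun k _ => ?_
        rw [norm_mul, norm_pow, ← mul_assoc]
        gcongr
        exact h k
    _ ≤ _ := by rw [← Finset.mul_sum]; gcongr

/-- Among `N + 1` equally spaced radii one is well separated from a given set of at most `N`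
numbers. -/
theorem exists_separated_radius (N : ℕ) (R : ℝ) (hR : 0 < R) (F : Finset ℝ) (hF : F.card ≤ N) :
    ∃ ρ, 0 < ρ ∧ ρ ≤ R ∧ ∀ x ∈ F, R / (2 * (N + 1)) ≤ |x - ρ| := by
  by_contra! hcon
  have h1 : ∀ i : Fin (N + 1), ∃ x ∈ F, |x - R * (i + 1) / (N + 1)| < R / (2 * (N + 1)) := by
    intro i
    apply hcon
    · positivity
    · rw [div_le_iff₀ (by positivity)]
      gcongr
      exact_mod_cast Nat.lt_succ_iff.mp i.2
  choose x hx hx' using h1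
  have hinj : Function.Injective x := by
    intro i j hij
    have hi := hx' i
    have hj := hx' j
    rw [hij] at hi
    by_contra hne
    have h2 : (1 : ℝ) ≤ |((i : ℕ) : ℝ) - ((j : ℕ) : ℝ)| := by
      have : (1 : ℤ) ≤ |((i : ℕ) : ℤ) - ((j : ℕ) : ℤ)| :=
        Int.one_le_abs (sub_ne_zero.mpr fun h => hne (Fin.ext (by exact_mod_cast h)))
      exact_mod_cast this
    have h3 : R / (N + 1) * |((i : ℕ) : ℝ) - ((j : ℕ) : ℝ)|
        = |(x j - R * (j + 1) / (N + 1)) - (x j - R * (i + 1) / (N + 1))| := by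
      rw [← abs_of_pos (show 0 < R / (N + 1) by positivity), ← abs_mul]
      congr 1; field_simp; ring
    have h4 := abs_sub (x j - R * (j + 1) / (N + 1)) (x j - R * (i + 1) / (N + 1))
    have h5 : R / (N + 1) * 1 ≤ R / (N + 1) * |((i : ℕ) : ℝ) - ((j : ℕ) : ℝ)| := by gcongr
    have h6 : R / (2 * (N + 1)) + R / (2 * (N + 1)) = R / (N + 1) := by field_simp; norm_num
    linarith
  have := Finset.card_le_card_of_injOn x (s := Finset.univ) (t := F) (fun i _ => hx i)
    hinj.injOn
  simp at this; omega

open Polynomial unitInterval in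
/-- A continuous root of a family of monic polynomials whose coefficients are relatively close is
itself relatively close. -/
theorem exists_relClose_of_root (N : ℕ) {η : ℝ} (hη : 0 < η) :
    ∃ ε : ℝ, 0 < ε ∧ ∀ q : I → ℂ[X], (∀ s, (q s).Monic) → (∀ s, (q s).natDegree = N) →
      (∀ k, RelClose ε fun s => (q s).coeff k) → ∀ ξ : I → ℂ, Continuous ξ →
      (∀ s, (q s).eval (ξ s) = 0) → RelClose η ξ := by
  wlog hη2 : η ≤ 1 / 2 generalizing η
  · obtain ⟨ε, hε, h⟩ := this (η := 1 / 2) (by norm_num) le_rfl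
    exact ⟨ε, hε, fun q h1 h2 h3 ξ h4 h5 => (h q h1 h2 h3 ξ h4 h5).mono (by linarith)⟩
  set β := η / (2 * (N + 1)) with hβ
  have hβ0 : 0 < β := by positivity
  set κ := 1 / (3 / β + 1) with hκ
  have hκ0 : 0 < κ := by positivity
  refine ⟨κ ^ N / 2, by positivity, fun q hm hd hc ξ hξ hr => ?_⟩
  have key : ∀ s t, ξ t ≠ 0 → ‖ξ s - ξ t‖ ≤ η * ‖ξ t‖ := by
    intro s t ht
    by_contra! hlt
    have hcard : (q t).roots.card = N := by
      rw [← hd t]; exact (IsAlgClosed.splits _).natDegree_eq_card_roots.symm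
    have ht0 : 0 < ‖ξ t‖ := norm_pos_iff.mpr ht
    obtain ⟨ρ, hρ0, hρR, hρ⟩ := exists_separated_radius N (η * ‖ξ t‖) (by positivity)
      ((q t).roots.map fun r => ‖r - ξ t‖).toFinset
      ((Multiset.toFinset_card_le _).trans (by simp [hcard]))
    obtain ⟨s', hs'⟩ := mem_range_of_exists_le_of_exists_ge
      (f := fun s => ‖ξ s - ξ t‖) (c := ρ) (by fun_prop) ⟨t, by simpa using hρ0.le⟩
      ⟨s, by linarith⟩
    simp only at hs'
    have hw : ‖ξ s'‖ ≤ 3 / 2 * ‖ξ t‖ := by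
      have := norm_sub_norm_le (ξ s') (ξ t)
      nlinarith
    have hw0 : 0 < ‖ξ s'‖ := by
      have := norm_sub_norm_le (ξ t) (ξ s')
      rw [norm_sub_rev] at this
      nlinarith
    have h1 : ∀ r ∈ (q t).roots, κ * (‖ξ s'‖ + ‖r‖) ≤ ‖ξ s' - r‖ := by
      intro r hmem
      have h2 := hρ ‖r - ξ t‖ (by
        rw [Multiset.mem_toFinset]; exact Multiset.mem_map_of_mem _ hmem)
      have h3 : |‖r - ξ t‖ - ρ| ≤ ‖ξ s' - r‖ := by
        rw [← hs', norm_sub_rev (ξ s') r]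
        have := abs_norm_sub_norm_le (r - ξ t) (ξ s' - ξ t)
        simpa using this
      have h4 : β * ‖ξ t‖ ≤ ‖ξ s' - r‖ := by
        refine le_trans (le_of_eq ?_) (h2.trans h3)
        rw [hβ]; ring
      have h5 : ‖r‖ ≤ ‖ξ s'‖ + ‖ξ s' - r‖ := by
        have := norm_sub_norm_le r (ξ s')
        rw [norm_sub_rev] at this; linarith
      rw [hκ, one_div, inv_mul_le_iff₀ (by positivity)]
      have h6 : 3 * ‖ξ t‖ ≤ 3 / β * ‖ξ s' - r‖ := by
        calc 3 * ‖ξ t‖ = 3 / β * (β * ‖ξ t‖) := by field_simp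
          _ ≤ _ := by gcongr
      linarith
    have h2 : κ ^ N * ((q t).roots.map fun r => ‖ξ s'‖ + ‖r‖).prod ≤ ‖(q t).eval (ξ s')‖ := by
      rw [norm_monic_eval_eq_prod_roots (hm t)]
      calc _ = ((q t).roots.map fun r => κ * (‖ξ s'‖ + ‖r‖)).prod := by
            rw [Multiset.prod_map_mul]; simp [hcard]
        _ ≤ _ := Multiset.prod_map_le_prod_map₀ _ _ (fun r _ => by positivity) h1
    have h3 := norm_eval_le_of_relClose (hm t) ((hd s').trans (hd t).symm)
      (by positivity : 0 ≤ κ ^ N / 2) (fun k => by rw [norm_sub_rev]; exact hc k s' t) (hr s')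
    have h4 : 0 < ((q t).roots.map fun r => ‖ξ s'‖ + ‖r‖).prod := by
      refine Multiset.prod_pos fun x hx => ?_
      obtain ⟨r, -, rfl⟩ := Multiset.mem_map.mp hx
      positivity
    have h5 : 0 < κ ^ N * ((q t).roots.map fun r => ‖ξ s'‖ + ‖r‖).prod := by positivity
    linarith
  intro s t
  by_cases ht : ξ t = 0
  · by_cases hs : ξ s = 0
    · simp [hs, ht]
    · have := key t s hs
      rw [ht, zero_sub, norm_neg] at this
      have := norm_pos_iff.mpr hs
      nlinarith
  · exact key s t ht

open Polynomial in
/-- A uniform bound for the roots of monic polynomials in terms of a bound for the coefficients. -/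
theorem norm_root_le_of_coeff_le {g : ℂ[X]} (hg : g.Monic) {M : ℝ} (hM : 0 ≤ M)
    (h : ∀ k, k < g.natDegree → ‖g.coeff k‖ ≤ M) {z : ℂ} (hz : g.eval z = 0) : ‖z‖ ≤ M + 1 := by
  lift M to NNReal using hM
  have h1 := Polynomial.IsRoot.norm_lt_cauchyBound hg.ne_zero hz
  have h2 : g.cauchyBound ≤ M + 1 := by
    simp only [Polynomial.cauchyBound, hg.leadingCoeff, nnnorm_one, div_one]
    gcongr
    refine Finset.sup_le fun k hk => ?_
    exact h k (Finset.mem_range.mp hk)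
  have h3 := (h1.trans_le h2).le
  exact_mod_cast h3

open Polynomial in
/-- Roots of monic polynomials of bounded degree and coefficients depend uniformly continuously on
the coefficients. -/
theorem exists_root_near (d : ℕ) (M : ℝ) {η : ℝ} (hη : 0 < η) :
    ∃ e : ℝ, 0 < e ∧ ∀ f g : ℂ[X], f.Monic → g.Monic → f.natDegree = d → g.natDegree = d →
      (∀ k, k < d → ‖f.coeff k‖ ≤ M) → (∀ k, k < d → ‖f.coeff k - g.coeff k‖ ≤ e) →
      ∀ z, g.eval z = 0 → ∃ a, f.eval a = 0 ∧ ‖z - a‖ ≤ η := by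
  wlog hM : 0 ≤ M generalizing M
  · obtain ⟨e, he, h⟩ := this 0 le_rfl
    exact ⟨e, he, fun f g h1 h2 h3 h4 h5 h6 =>
      h f g h1 h2 h3 h4 (fun k hk => (h5 k hk).trans (by linarith)) h6⟩
  set B := M + 1 + 1 with hB
  set c : ℝ := (d + 1) * B ^ d with hc
  have hc0 : 0 < c := by positivity
  refine ⟨min 1 (η ^ d / (2 * c)), by positivity, fun f g hf hg hdf hdg hM' he z hz => ?_⟩
  by_contra! hcon
  have hzB : ‖z‖ ≤ B := by
    refine norm_root_le_of_coeff_le hg (by linarith : 0 ≤ M + 1) (fun k hk => ?_) hz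
    have h1 := norm_sub_norm_le (g.coeff k) (f.coeff k)
    rw [norm_sub_rev] at h1
    have := he k (hdg ▸ hk)
    have := hM' k (hdg ▸ hk)
    have := min_le_left 1 (η ^ d / (2 * c))
    linarith
  have e1 : f.eval z = ∑ k ∈ Finset.range (d + 1), (f.coeff k - g.coeff k) * z ^ k := by
    simp only [sub_mul, Finset.sum_sub_distrib]
    rw [← Polynomial.eval_eq_sum_range' (by omega), ← Polynomial.eval_eq_sum_range' (by omega), hz,
      sub_zero]
  have h1 : ‖f.eval z‖ ≤ η ^ d / 2 := by
    rw [e1]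
    calc _ ≤ ∑ k ∈ Finset.range (d + 1), (η ^ d / (2 * c)) * B ^ d := by
          refine norm_sum_le_of_le _ fun k hk => ?_
          rw [norm_mul, norm_pow]
          have hk' : k ≤ d := Nat.lt_succ_iff.mp (Finset.mem_range.mp hk)
          gcongr
          · rcases hk'.lt_or_eq with h | rfl
            · exact (he k h).trans (min_le_right _ _)
            · have hf1 : f.coeff k = 1 := by rw [← hdf]; exact hf
              have hg1 : g.coeff k = 1 := by rw [← hdg]; exact hg
              rw [hf1, hg1]; simp; positivity
          · calc ‖z‖ ^ k ≤ B ^ k := by gcongr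
              _ ≤ B ^ d := pow_le_pow_right₀ (by linarith) hk'
      _ = η ^ d / 2 := by
          rw [Finset.sum_const, Finset.card_range, nsmul_eq_mul, hc]
          have : B ^ d ≠ 0 := by positivity
          push_cast
          field_simp
  have h2 : η ^ d ≤ ‖f.eval z‖ := by
    rw [norm_monic_eval_eq_prod_roots hf]
    have hcard : f.roots.card = d := by
      rw [← hdf]; exact (IsAlgClosed.splits _).natDegree_eq_card_roots.symm
    calc η ^ d = (f.roots.map fun _ => η).prod := by simp [hcard]
      _ ≤ _ := Multiset.prod_map_le_prod_map₀ _ _ (fun r _ => hη.le) fun r hr =>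
          (hcon r (Polynomial.isRoot_of_mem_roots hr)).le
  have : 0 < η ^ d := by positivity
  linarith

open Polynomial in
/-- Nonzero roots of a family of monic polynomials with relatively close coefficients are uniformly
bounded away from zero. -/
theorem exists_root_separation (N : ℕ) : ∃ ε : ℝ, 0 < ε ∧ ∀ (S : Type) (q : S → ℂ[X]),
    (∀ s, (q s).Monic) → (∀ s, (q s).natDegree = N) → (∀ k, RelClose ε fun s => (q s).coeff k) →
    ∃ σ : ℝ, 0 < σ ∧ ∀ s z, (q s).eval z = 0 → z ≠ 0 → σ ≤ ‖z‖ := by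
  refine ⟨(1 / 3) ^ N / 2, by positivity, fun S q hm hd hc => ?_⟩
  rcases isEmpty_or_nonempty S with hS | ⟨⟨t⟩⟩
  · exact ⟨1, one_pos, fun s => isEmptyElim s⟩
  have hcard : (q t).roots.card = N := by
    rw [← hd t]; exact (IsAlgClosed.splits _).natDegree_eq_card_roots.symm
  obtain ⟨m, hm0, hmin⟩ : ∃ m : ℝ, 0 < m ∧ ∀ r ∈ (q t).roots, r ≠ 0 → m ≤ ‖r‖ := by
    generalize (q t).roots = R
    induction R using Multiset.induction_on with
    | empty => exact ⟨1, one_pos, by simp⟩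
    | cons a R ih =>
      obtain ⟨m, hm0, h⟩ := ih
      by_cases ha : a = 0
      · refine ⟨m, hm0, fun r hr hr0 => ?_⟩
        rcases Multiset.mem_cons.mp hr with rfl | hr
        · exact absurd ha hr0
        · exact h r hr hr0
      · refine ⟨min m ‖a‖, lt_min hm0 (norm_pos_iff.mpr ha), fun r hr hr0 => ?_⟩
        rcases Multiset.mem_cons.mp hr with rfl | hr
        · exact min_le_right _ _
        · exact (min_le_left _ _).trans (h r hr hr0)
  refine ⟨m / 2, by positivity, fun s z hz hz0 => ?_⟩
  by_contra! hlt
  have hzp := norm_pos_iff.mpr hz0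
  have h1 := norm_eval_le_of_relClose (hm t) ((hd s).trans (hd t).symm)
    (by positivity : (0 : ℝ) ≤ (1 / 3) ^ N / 2)
    (fun k => by rw [norm_sub_rev]; exact hc k s t) hz
  rw [norm_monic_eval_eq_prod_roots (hm t)] at h1
  have h2 : (1 / 3) ^ N * ((q t).roots.map fun r => ‖z‖ + ‖r‖).prod
      ≤ ((q t).roots.map fun r => ‖z - r‖).prod := by
    calc _ = ((q t).roots.map fun r => 1 / 3 * (‖z‖ + ‖r‖)).prod := by
          rw [Multiset.prod_map_mul]; simp [hcard]
      _ ≤ _ := Multiset.prod_map_le_prod_map₀ _ _ (fun r _ => by positivity) fun r hr => by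
          by_cases hr0 : r = 0
          · simp only [hr0, norm_zero, add_zero, sub_zero]; linarith
          · have := hmin r hr hr0
            have := norm_sub_norm_le r z
            rw [norm_sub_rev] at this
            linarith
  have h3 : 0 < ((q t).roots.map fun r => ‖z‖ + ‖r‖).prod := by
    refine Multiset.prod_pos fun x hx => ?_
    obtain ⟨r, -, rfl⟩ := Multiset.mem_map.mp hx
    positivity
  have h4 : (0 : ℝ) < (1 / 3) ^ N * ((q t).roots.map fun r => ‖z‖ + ‖r‖).prod := by positivity
  linarith

open Polynomial in
/-- Continuity of the evaluation of a family of polynomials of constant degree. -/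
theorem continuous_eval_of_coeff {Y : Type*} [TopologicalSpace Y] {p : Y → ℂ[X]} {d : ℕ}
    (hd : ∀ y, (p y).natDegree = d) (hc : ∀ k, Continuous fun y => (p y).coeff k)
    {g : Y → ℂ} (hg : Continuous g) : Continuous fun y => (p y).eval (g y) := by
  have : ∀ y, (p y).eval (g y) = ∑ k ∈ Finset.range (d + 1), (p y).coeff k * g y ^ k := fun y =>
    Polynomial.eval_eq_sum_range' (by rw [hd]; omega) _
  simp only [this]
  fun_prop

open Polynomial unitInterval in
/-- If the distinct roots of a continuous family of monic polynomials over the unit interval stay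
uniformly separated, every root extends to a continuous root of the family. -/
theorem exists_root_curve {d : ℕ} {p : I → ℂ[X]} (hm : ∀ s, (p s).Monic)
    (hd : ∀ s, (p s).natDegree = d) (hc : ∀ k, Continuous fun s => (p s).coeff k)
    {τ : ℝ} (hτ : 0 < τ)
    (hsep : ∀ s a b, (p s).eval a = 0 → (p s).eval b = 0 → a ≠ b → τ ≤ ‖a - b‖)
    {s₀ : I} {a : ℂ} (ha : (p s₀).eval a = 0) :
    ∃ b : C(I, ℂ), b s₀ = a ∧ ∀ s, (p s).eval (b s) = 0 := by
  obtain ⟨M, hM0, hM⟩ : ∃ M : ℝ, 0 ≤ M ∧ ∀ k, k < d → ∀ s, ‖(p s).coeff k‖ ≤ M := by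
    have h1 : ∀ k, ∃ M : ℝ, 0 ≤ M ∧ ∀ s, ‖(p s).coeff k‖ ≤ M := fun k =>
      ⟨‖(⟨_, hc k⟩ : C(I, ℂ))‖, norm_nonneg _,
        fun s => ContinuousMap.norm_coe_le_norm (⟨_, hc k⟩ : C(I, ℂ)) s⟩
    choose M hM0 hM using h1
    refine ⟨∑ k ∈ Finset.range d, M k, Finset.sum_nonneg fun k _ => hM0 k, fun k hk s => ?_⟩
    exact (hM k s).trans
      (Finset.single_le_sum (fun k _ => hM0 k) (Finset.mem_range.mpr hk))
  let E : Set (I × ℂ) := {y | (p y.1).eval y.2 = 0}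
  have hEclosed : IsClosed E := isClosed_eq
    (continuous_eval_of_coeff (p := fun y : I × ℂ => p y.1) (fun y => hd _)
      (fun k => (hc k).comp continuous_fst) continuous_snd) continuous_const
  have hEcompact : IsCompact E := by
    refine (isCompact_univ.prod (isCompact_closedBall (0 : ℂ) (M + 1))).of_isClosed_subset hEclosed
      fun y hy => ⟨Set.mem_univ _, ?_⟩
    rw [mem_closedBall_zero_iff]
    exact norm_root_le_of_coeff_le (hm _) hM0 (fun k hk => hM k (hd y.1 ▸ hk) _) hy
  have : CompactSpace E := isCompact_iff_compactSpace.mp hEcompact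
  let π : E → I := fun y => y.1.1
  have hπ : Continuous π := by fun_prop
  have hopen : IsOpenMap π := by
    rw [isOpenMap_iff_nhds_le]
    rintro ⟨⟨s, z⟩, hz⟩ U hU
    rw [Filter.mem_map, mem_nhds_subtype] at hU
    obtain ⟨V, hV, hVU⟩ := hU
    obtain ⟨V₁, hV₁, V₂, hV₂, hV₁₂⟩ := mem_nhds_prod_iff.mp hV
    obtain ⟨δ, hδ, hδV⟩ := Metric.mem_nhds_iff.mp hV₂
    obtain ⟨e, he, hnear⟩ := exists_root_near d M (half_pos hδ)
    have h1 : ∀ᶠ s' in nhds s, ∀ k ∈ Finset.range d, ‖(p s').coeff k - (p s).coeff k‖ ≤ e := by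
      rw [Filter.eventually_all_finset]
      intro k _
      have : Continuous fun s' => ‖(p s').coeff k - (p s).coeff k‖ := by fun_prop
      refine this.continuousAt.eventually (p := fun x => x ≤ e) ?_
      simp only [sub_self, norm_zero]
      exact eventually_le_nhds he
    filter_upwards [h1, hV₁] with s' hs' hs'V
    obtain ⟨z', hz', hzz⟩ := hnear (p s') (p s) (hm _) (hm _) (hd _) (hd _)
      (fun k hk => hM k hk _) (fun k hk => hs' k (Finset.mem_range.mpr hk)) z hz
    have : (⟨(s', z'), hz'⟩ : E) ∈ π ⁻¹' U := hVU (hV₁₂ ⟨hs'V, hδV (by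
      rw [Metric.mem_ball, dist_comm, dist_eq_norm]; linarith)⟩)
    exact this
  have hloc : IsLocalHomeomorph π := by
    rw [isLocalHomeomorph_iff_isOpenEmbedding_restrict]
    rintro ⟨⟨s, z⟩, hz⟩
    let U : Set E := {y | dist y.1.2 z < τ / 2}
    have hU : IsOpen U := isOpen_lt (by fun_prop) continuous_const
    refine ⟨U, hU.mem_nhds (by simp [U, hτ]), ?_⟩
    refine Topology.IsOpenEmbedding.of_continuous_injective_isOpenMap
      (by exact hπ.comp continuous_subtype_val) ?_ (hopen.comp hU.isOpenMap_subtype_val)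
    rintro ⟨⟨⟨s₁, z₁⟩, h₁⟩, hu₁⟩ ⟨⟨⟨s₂, z₂⟩, h₂⟩, hu₂⟩ heq
    have hs : s₁ = s₂ := heq
    subst hs
    by_cases hzz : z₁ = z₂
    · subst hzz; rfl
    · have h3 := hsep s₁ z₁ z₂ h₁ h₂ hzz
      have h4 : dist z₁ z < τ / 2 := hu₁
      have h5 : dist z₂ z < τ / 2 := hu₂
      have := dist_triangle_right z₁ z₂ z
      rw [dist_eq_norm z₁ z₂] at this
      linarith
  have hcov : IsCoveringMap π := isLocalHomeomorph_iff_isCoveringMap.mp hloc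
  obtain ⟨F, ⟨hF, hF'⟩, -⟩ := hcov.existsUnique_continuousMap_lifts
    (⟨Set.projIcc (0 : ℝ) 1 zero_le_one, continuous_projIcc⟩ : C(ℝ, I)) (s₀ : ℝ)
    ⟨(s₀, a), ha⟩ (Set.projIcc_val zero_le_one s₀).symm
  refine ⟨⟨fun s => (F s).1.2, by fun_prop⟩, by simp [hF], fun s => ?_⟩
  have h1 : (F s).1.1 = s := (congrFun hF' s).trans (Set.projIcc_val zero_le_one s)
  have h2 : (p (F s).1.1).eval (F s).1.2 = 0 := (F s).2
  rwa [h1] at h2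

open unitInterval in
/-- The continuous roots of a family of polynomials over the unit interval. -/
def rootCurves (p : I → Polynomial ℂ) : Set C(I, ℂ) := {b | ∀ s, (p s).eval (b s) = 0}

open Polynomial unitInterval in
/-- A continuous family of monic polynomials of degree `d` over the unit interval whose roots are
organised in continuous curves with `η`-relatively close differences. -/
structure IsTame (η : ℝ) (d : ℕ) (p : I → ℂ[X]) : Prop where
  monic : ∀ s, (p s).Monic
  natDegree_eq : ∀ s, (p s).natDegree = d
  continuous_coeff : ∀ k, Continuous fun s => (p s).coeff k
  relClose : ∀ b ∈ rootCurves p, ∀ b' ∈ rootCurves p, RelClose η fun s => b s - b' s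
  exists_curve : ∀ s a, (p s).eval a = 0 → ∃ b ∈ rootCurves p, b s = a

open Polynomial unitInterval in
/-- A family of monic polynomials is tame if the differences of its roots are roots of a family of
monic polynomials with relatively close coefficients. -/
theorem exists_isTame (d N : ℕ) {η : ℝ} (hη : 0 < η) : ∃ δ : ℝ, 0 < δ ∧ ∀ p q : I → ℂ[X],
    (∀ s, (p s).Monic) → (∀ s, (p s).natDegree = d) →
    (∀ k, Continuous fun s => (p s).coeff k) → (∀ s, (q s).Monic) →
    (∀ s, (q s).natDegree = N) → (∀ k, RelClose δ fun s => (q s).coeff k) →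
    (∀ s a b, (p s).eval a = 0 → (p s).eval b = 0 → (q s).eval (a - b) = 0) → IsTame η d p := by
  obtain ⟨δ₁, hδ₁, h₁⟩ := exists_relClose_of_root N hη
  obtain ⟨δ₂, hδ₂, h₂⟩ := exists_root_separation N
  refine ⟨min δ₁ δ₂, lt_min hδ₁ hδ₂, fun p q hp hpd hpc hq hqd hqc hdiff => ?_⟩
  obtain ⟨τ, hτ, hsep⟩ := h₂ I q hq hqd fun k => (hqc k).mono (min_le_right _ _)
  refine ⟨hp, hpd, hpc, fun b hb b' hb' => ?_, fun s a ha => ?_⟩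
  · exact h₁ q hq hqd (fun k => (hqc k).mono (min_le_left _ _)) _ (by fun_prop)
      fun s => hdiff s _ _ (hb s) (hb' s)
  · obtain ⟨b, hb, hb'⟩ := exists_root_curve hp hpd hpc hτ
      (fun s a b ha hb hab => hsep s _ (hdiff s a b ha hb) (sub_ne_zero.mpr hab)) ha
    exact ⟨b, hb', hb⟩

/-- If a connected space is covered by finitely many closed sets, any two of which are equal or
disjoint, then one of them is the whole space. -/
theorem exists_forall_mem_of_isClosed_cover {X ι : Type*} [TopologicalSpace X]
    [PreconnectedSpace X] [Nonempty X] [Finite ι] (A : ι → Set X) (hA : ∀ i, IsClosed (A i))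
    (hcov : ∀ x, ∃ i, x ∈ A i) (hdisj : ∀ x i j, x ∈ A i → x ∈ A j → A i = A j) :
    ∃ i, ∀ x, x ∈ A i := by
  obtain ⟨x₀⟩ := ‹Nonempty X›
  obtain ⟨i, hi⟩ := hcov x₀
  refine ⟨i, fun x => ?_⟩
  have hopen : IsOpen (A i) := by
    rw [← isClosed_compl_iff]
    have : (A i)ᶜ = ⋃ j ∈ {j | A j ≠ A i}, A j := by
      ext y
      simp only [Set.mem_compl_iff, Set.mem_iUnion, Set.mem_ofPred_eq, exists_prop]
      constructor
      · intro hy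
        obtain ⟨j, hj⟩ := hcov y
        exact ⟨j, fun h => hy (h ▸ hj), hj⟩
      · rintro ⟨j, hne, hj⟩ hy
        exact hne (hdisj y j i hj hy)
    rw [this]
    exact (Set.toFinite _).isClosed_biUnion fun j _ => hA j
  have := IsClopen.eq_univ ⟨hA i, hopen⟩ ⟨x₀, hi⟩
  rw [this]; trivial

namespace IsTame

open Polynomial unitInterval

variable {η : ℝ} {d : ℕ} {p : I → ℂ[X]}

theorem eq_of_apply_eq (h : IsTame η d p) {b b' : C(I, ℂ)} (hb : b ∈ rootCurves p)
    (hb' : b' ∈ rootCurves p) {s : I} (hs : b s = b' s) : b = b' := by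
  ext t
  exact sub_eq_zero.mp ((h.relClose b hb b' hb').eq_zero (t := s) (sub_eq_zero.mpr hs) t)

theorem finite (h : IsTame η d p) : (rootCurves p).Finite := by
  refine Set.Finite.of_finite_image (f := fun b => b 0) ?_ fun b hb b' hb' hbb =>
    h.eq_of_apply_eq hb hb' hbb
  refine Set.Finite.subset (p 0).roots.toFinset.finite_toSet ?_
  rintro _ ⟨b, hb, rfl⟩
  simpa [(h.monic 0).ne_zero] using hb 0

theorem nonempty (h : IsTame η d p) (hd : d ≠ 0) : (rootCurves p).Nonempty := by
  obtain ⟨a, ha⟩ := IsAlgClosed.exists_root (p 0) (by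
    rw [Polynomial.degree_eq_natDegree (h.monic 0).ne_zero, h.natDegree_eq]
    exact_mod_cast hd)
  obtain ⟨b, hb, -⟩ := h.exists_curve 0 a ha
  exact ⟨b, hb⟩

/-- Distinct root curves are uniformly separated. -/
theorem exists_separation (h : IsTame η d p) : ∃ τ : ℝ, 0 < τ ∧
    ∀ b ∈ rootCurves p, ∀ b' ∈ rootCurves p, ∀ s, ‖b s - b' s‖ < τ → b = b' := by
  have h1 : ∀ bb ∈ rootCurves p ×ˢ rootCurves p, ∃ τ : ℝ, 0 < τ ∧
      ∀ s, ‖bb.1 s - bb.2 s‖ < τ → bb.1 = bb.2 := by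
    rintro ⟨b, b'⟩ ⟨hb, hb'⟩
    by_cases hbb : b = b'
    · exact ⟨1, one_pos, fun _ _ => hbb⟩
    · obtain ⟨s₀, -, hs₀⟩ := isCompact_univ.exists_isMinOn (Set.univ_nonempty (α := I))
        (f := fun s => ‖b s - b' s‖) (by fun_prop)
      refine ⟨‖b s₀ - b' s₀‖, norm_pos_iff.mpr (sub_ne_zero.mpr fun h' =>
        hbb (h.eq_of_apply_eq hb hb' h')), fun s hs => ?_⟩
      exact absurd hs (not_lt.mpr (hs₀ (Set.mem_univ s)))
  choose! τ hτ hτ' using h1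
  have hfin := (h.finite.prod h.finite)
  obtain ⟨τ₀, hτ₀, hmin⟩ : ∃ τ₀ : ℝ, 0 < τ₀ ∧ ∀ bb ∈ hfin.toFinset, τ₀ ≤ τ bb := by
    rcases hfin.toFinset.eq_empty_or_nonempty with he | hne
    · exact ⟨1, one_pos, by simp [he]⟩
    · obtain ⟨x, hx, hx'⟩ := hfin.toFinset.exists_min_image τ hne
      exact ⟨τ x, hτ x (hfin.mem_toFinset.mp hx), hx'⟩
  exact ⟨τ₀, hτ₀, fun b hb b' hb' s hs => hτ' (b, b') ⟨hb, hb'⟩ s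
    (hs.trans_le (hmin _ (hfin.mem_toFinset.mpr ⟨hb, hb'⟩)))⟩

/-- Root curves depend continuously on parameters. -/
theorem eventually_dist_le {W : Type*} [TopologicalSpace W] {p : I → W → ℂ[X]}
    (h : ∀ w, IsTame η d fun s => p s w)
    (hc : ∀ k, Continuous fun y : I × W => (p y.1 y.2).coeff k) (w₀ : W) {r : ℝ} (hr : 0 < r) :
    ∀ᶠ w in nhds w₀,
      (∀ b ∈ rootCurves (fun s => p s w), ∃ b₀ ∈ rootCurves (fun s => p s w₀), dist b b₀ ≤ r) ∧
      ∀ b₀ ∈ rootCurves (fun s => p s w₀), ∃ b ∈ rootCurves (fun s => p s w), dist b b₀ ≤ r := by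
  obtain ⟨τ, hτ, hsep⟩ := (h w₀).exists_separation
  wlog hrτ : r < τ / 2 generalizing r
  · filter_upwards [this (r := τ / 4) (by positivity) (by linarith)] with w hw
    refine ⟨fun b hb => ?_, fun b hb => ?_⟩
    · obtain ⟨b₀, hb₀, hd⟩ := hw.1 b hb
      exact ⟨b₀, hb₀, by linarith⟩
    · obtain ⟨b₀, hb₀, hd⟩ := hw.2 b hb
      exact ⟨b₀, hb₀, by linarith⟩
  have hM : ∀ k, ∃ M : ℝ, 0 ≤ M ∧ ∀ s, ‖(p s w₀).coeff k‖ ≤ M := fun k =>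
    ⟨‖(⟨_, (h w₀).continuous_coeff k⟩ : C(I, ℂ))‖, norm_nonneg _,
      fun s => ContinuousMap.norm_coe_le_norm (⟨_, (h w₀).continuous_coeff k⟩ : C(I, ℂ)) s⟩
  choose M hM0 hM using hM
  obtain ⟨e, he, hnear⟩ := exists_root_near d (∑ k ∈ Finset.range d, M k + 1) hr
  have h1 : ∀ᶠ w in nhds w₀, ∀ s ∈ (Set.univ : Set I), ∀ k ∈ Finset.range d,
      ‖(p s w).coeff k - (p s w₀).coeff k‖ ≤ min e 1 := by
    refine isCompact_univ.eventually_forall_of_forall_eventually fun s _ => ?_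
    rw [Filter.eventually_all_finset]
    intro k _
    have : Continuous fun y : W × I => ‖(p y.2 y.1).coeff k - (p y.2 w₀).coeff k‖ := by
      have h1 := (hc k).comp (f := fun y : W × I => (y.2, y.1)) (by fun_prop)
      have h2 := (hc k).comp (f := fun y : W × I => (y.2, w₀)) (by fun_prop)
      exact (h1.sub h2).norm
    refine this.continuousAt.eventually (p := fun x => x ≤ min e 1) ?_
    simp only [sub_self, norm_zero]
    exact eventually_le_nhds (by positivity)
  filter_upwards [h1] with w hw
  have hMw₀ : ∀ s k, k < d → ‖(p s w₀).coeff k‖ ≤ ∑ k ∈ Finset.range d, M k := fun s k hk =>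
    (hM k s).trans (Finset.single_le_sum (fun k _ => hM0 k) (Finset.mem_range.mpr hk))
  have hMw : ∀ s k, k < d → ‖(p s w).coeff k‖ ≤ ∑ k ∈ Finset.range d, M k + 1 := by
    intro s k hk
    have h2 := (hw s trivial k (Finset.mem_range.mpr hk)).trans (min_le_right _ _)
    have h3 := norm_sub_norm_le ((p s w).coeff k) ((p s w₀).coeff k)
    linarith [hMw₀ s k hk]
  have hforth : ∀ b ∈ rootCurves (fun s => p s w), ∃ b₀ ∈ rootCurves (fun s => p s w₀),
      dist b b₀ ≤ r := by
    intro b hb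
    have : Finite (rootCurves fun s => p s w₀) := (h w₀).finite
    obtain ⟨⟨b₀, hb₀⟩, hall⟩ := exists_forall_mem_of_isClosed_cover
      (fun b₀ : rootCurves (fun s => p s w₀) => {s | ‖b s - b₀.1 s‖ ≤ r})
      (fun b₀ => isClosed_le (by fun_prop) continuous_const) (fun s => by
        obtain ⟨a, ha, hab⟩ := hnear (p s w₀) (p s w) ((h w₀).monic s) ((h w).monic s)
          ((h w₀).natDegree_eq s) ((h w).natDegree_eq s)
          (fun k hk => (hMw₀ s k hk).trans (by linarith)) (fun k hk => by
            rw [norm_sub_rev]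
            exact (hw s trivial k (Finset.mem_range.mpr hk)).trans (min_le_left _ _)) _ (hb s)
        obtain ⟨b₀, hb₀, hb₀s⟩ := (h w₀).exists_curve s a ha
        exact ⟨⟨b₀, hb₀⟩, by simpa [hb₀s] using hab⟩)
      (by
        rintro s ⟨b₁, hb₁⟩ ⟨b₂, hb₂⟩ h₁ h₂
        have : b₁ = b₂ := hsep b₁ hb₁ b₂ hb₂ s (by
          simp only [Set.mem_ofPred_eq] at h₁ h₂
          have := norm_sub_le (b s - b₂ s) (b s - b₁ s)
          rw [sub_sub_sub_cancel_left] at this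
          linarith)
        subst this; rfl)
    refine ⟨b₀, hb₀, (ContinuousMap.dist_le hr.le).mpr fun s => ?_⟩
    rw [dist_eq_norm]
    exact hall s
  refine ⟨hforth, fun b₀ hb₀ => ?_⟩
  obtain ⟨a, ha, hab⟩ := hnear (p 0 w) (p 0 w₀) ((h w).monic 0) ((h w₀).monic 0)
    ((h w).natDegree_eq 0) ((h w₀).natDegree_eq 0)
    (hMw 0) (fun k hk =>
      (hw 0 trivial k (Finset.mem_range.mpr hk)).trans (min_le_left _ _)) _ (hb₀ 0)
  obtain ⟨b, hb, hb0⟩ := (h w).exists_curve 0 a ha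
  obtain ⟨b₀', hb₀', hbb⟩ := hforth b hb
  have : b₀' = b₀ := hsep b₀' hb₀' b₀ hb₀ 0 (by
    have h3 := ContinuousMap.dist_le_iff_of_nonempty.mp hbb 0
    rw [dist_eq_norm, hb0] at h3
    have := norm_add_le (b₀ 0 - a) (a - b₀' 0)
    rw [sub_add_sub_cancel, norm_sub_rev] at this
    linarith)
  exact ⟨b, hb, this ▸ hbb⟩

end IsTame

/-- Finite infima of families with approximately the same values are close. -/
theorem abs_iInf_sub_iInf_le {ι κ : Type*} [Finite ι] [Nonempty ι] [Finite κ] [Nonempty κ]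
    {f : ι → ℝ} {g : κ → ℝ} {r : ℝ} (h : ∀ i, ∃ j, |f i - g j| ≤ r)
    (h' : ∀ j, ∃ i, |f i - g j| ≤ r) : |(⨅ i, f i) - ⨅ j, g j| ≤ r := by
  rw [abs_le]
  constructor
  · have : (⨅ j, g j) - r ≤ ⨅ i, f i := le_ciInf fun i => by
      obtain ⟨j, hj⟩ := h i
      have := ciInf_le (Set.finite_range g).bddBelow j
      linarith [(abs_le.mp hj).1]
    linarith
  · have : (⨅ i, f i) - r ≤ ⨅ j, g j := le_ciInf fun j => by
      obtain ⟨i, hi⟩ := h' j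
      have := ciInf_le (Set.finite_range f).bddBelow i
      linarith [(abs_le.mp hi).2]
    linarith

/-- McShane's formula extends a Lipschitz function on a finite set. -/
theorem iInf_add_mul_norm_eq {ι : Type*} [Finite ι] [Nonempty ι] {e : ℝ} {x : ι → ℂ} {u : ι → ℝ}
    (h : ∀ i j, |u i - u j| ≤ e * ‖x i - x j‖) (i : ι) :
    ⨅ j, (u j + e * ‖x i - x j‖) = u i := by
  apply le_antisymm
  · refine (ciInf_le (Set.finite_range _).bddBelow i).trans ?_
    simp
  · exact le_ciInf fun j => by linarith [(abs_le.mp (h i j)).2]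

theorem abs_iInf_add_mul_norm_sub_le {ι : Type*} [Finite ι] [Nonempty ι] {e : ℝ} (he : 0 ≤ e)
    (x : ι → ℂ) (u : ι → ℝ) (z z' : ℂ) :
    |(⨅ j, (u j + e * ‖z - x j‖)) - ⨅ j, (u j + e * ‖z' - x j‖)| ≤ e * ‖z - z'‖ := by
  have key : ∀ i, |(u i + e * ‖z - x i‖) - (u i + e * ‖z' - x i‖)| ≤ e * ‖z - z'‖ := fun i => by
    rw [add_sub_add_left_eq_sub, ← mul_sub, abs_mul, abs_of_nonneg he]
    gcongr
    simpa using abs_norm_sub_norm_le (z - x i) (z' - x i)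
  exact abs_iInf_sub_iInf_le (fun i => ⟨i, key i⟩) fun i => ⟨i, key i⟩

open Polynomial unitInterval in
/-- A parametrised McShane extension of the motion of the root curves, for a real-linear
functional `φ` of norm at most one. -/
theorem exists_mcShane_extension {W : Type*} [TopologicalSpace W] {η : ℝ} (hη : 0 ≤ η) {d : ℕ}
    (hd : d ≠ 0) {p : I → W → ℂ[X]} (h : ∀ w, IsTame η d fun s => p s w)
    (hc : ∀ k, Continuous fun y : I × W => (p y.1 y.2).coeff k)
    (φ : ℂ →L[ℝ] ℝ) (hφ : ∀ z, |φ z| ≤ ‖z‖) :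
    ∃ l : I → W → ℂ → ℝ, (Continuous fun y : I × W × ℂ => l y.1 y.2.1 y.2.2) ∧
      (∀ s w z z', |l s w z - l s w z'| ≤ η * ‖z - z'‖) ∧
      ∀ s w, ∀ b ∈ rootCurves (fun s => p s w), l s w (b 0) = φ (b s - b 0) := by
  have hfin : ∀ w, Finite (rootCurves fun s => p s w) := fun w => (h w).finite
  have hne : ∀ w, Nonempty (rootCurves fun s => p s w) := fun w => ((h w).nonempty hd).to_subtype
  let G : I → ℂ → C(I, ℂ) → ℝ := fun s z b => φ (b s - b 0) + η * ‖z - b 0‖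
  refine ⟨fun s w z => ⨅ b : rootCurves (fun s => p s w), G s z b.1, ?_, ?_, ?_⟩
  · rw [continuous_iff_continuousAt]
    rintro ⟨s₀, w₀, z₀⟩
    rw [Metric.continuousAt_iff']
    intro r hr
    have h1 : ∀ᶠ w in nhds w₀, _ := IsTame.eventually_dist_le h hc w₀
      (r := r / (2 * (2 * (2 + η)))) (by positivity)
    have h2 : ∀ᶠ sz in nhds (s₀, z₀), ∀ b₀ : rootCurves (fun s => p s w₀),
        |G sz.1 sz.2 b₀.1 - G s₀ z₀ b₀.1| ≤ r / 4 := by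
      rw [Filter.eventually_all]
      rintro ⟨b₀, -⟩
      have : Continuous fun sz : I × ℂ => |G sz.1 sz.2 b₀ - G s₀ z₀ b₀| := by
        simp only [G]; fun_prop
      refine this.continuousAt.eventually (p := fun x => x ≤ r / 4) ?_
      simp only [sub_self, abs_zero]
      exact eventually_le_nhds (by positivity)
    have hG : ∀ s z b b', |G s z b - G s z b'| ≤ (2 + η) * dist b b' := by
      intro s z b b'
      have h3 : ∀ t, ‖b t - b' t‖ ≤ dist b b' := fun t => by
        rw [← dist_eq_norm]; exact ContinuousMap.dist_apply_le_dist t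
      have h4 : G s z b - G s z b' = φ ((b s - b' s) - (b 0 - b' 0))
          + η * (‖z - b 0‖ - ‖z - b' 0‖) := by
        simp only [G, map_sub]; ring
      rw [h4]
      refine (abs_add_le _ _).trans ?_
      rw [abs_mul, abs_of_nonneg hη]
      have h5 : |‖z - b 0‖ - ‖z - b' 0‖| ≤ dist b b' := by
        refine (abs_norm_sub_norm_le _ _).trans ?_
        rw [sub_sub_sub_cancel_left, norm_sub_rev]
        exact h3 0
      have h6 := (hφ ((b s - b' s) - (b 0 - b' 0))).trans (norm_sub_le _ _)
      have := h3 s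
      have := h3 0
      have : η * |‖z - b 0‖ - ‖z - b' 0‖| ≤ η * dist b b' := by gcongr
      linarith
    have h1' := (continuous_snd.fst.tendsto (s₀, w₀, z₀)).eventually h1
    have hpr : Continuous fun y : I × W × ℂ => (y.1, y.2.2) := by fun_prop
    filter_upwards [h1', (hpr.tendsto (s₀, w₀, z₀)).eventually h2]
    rintro ⟨s, w, z⟩ ⟨hf, hb⟩ h2
    simp only at hf hb h2 ⊢
    rw [Real.dist_eq]
    refine lt_of_le_of_lt ?_ (half_lt_self hr)
    have h7 : ∀ b b₀ : C(I, ℂ), b₀ ∈ rootCurves (fun s => p s w₀) →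
        dist b b₀ ≤ r / (2 * (2 * (2 + η))) → |G s z b - G s₀ z₀ b₀| ≤ r / 2 := by
      intro b b₀ hb₀ hbb
      have h8 := h2 ⟨b₀, hb₀⟩
      have h9 := hG s z b b₀
      have h10 : (2 + η) * dist b b₀ ≤ r / 4 := by
        calc _ ≤ (2 + η) * (r / (2 * (2 * (2 + η)))) := by gcongr
          _ = r / 4 := by
            have : 2 + η ≠ 0 := by positivity
            field_simp; norm_num
      have := abs_sub_le (G s z b) (G s z b₀) (G s₀ z₀ b₀)
      linarith
    refine abs_iInf_sub_iInf_le ?_ ?_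
    · rintro ⟨b, hbm⟩
      obtain ⟨b₀, hb₀, hbb⟩ := hf b hbm
      exact ⟨⟨b₀, hb₀⟩, h7 b b₀ hb₀ hbb⟩
    · rintro ⟨b₀, hb₀⟩
      obtain ⟨b, hbm, hbb⟩ := hb b₀ hb₀
      exact ⟨⟨b, hbm⟩, h7 b b₀ hb₀ hbb⟩
  · intro s w z z'
    exact abs_iInf_add_mul_norm_sub_le hη (fun b : rootCurves (fun s => p s w) => b.1 0)
      (fun b => φ (b.1 s - b.1 0)) z z'
  · intro s w b hb
    refine iInf_add_mul_norm_eq (x := fun b : rootCurves (fun s => p s w) => b.1 0)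
      (u := fun b => φ (b.1 s - b.1 0)) (fun b b' => ?_) ⟨b, hb⟩
    rw [← map_sub]
    refine (hφ _).trans ?_
    have := (h w).relClose b b.2 b' b'.2 s 0
    rwa [show b.1 s - b.1 0 - (b'.1 s - b'.1 0) = b.1 s - b'.1 s - (b.1 0 - b'.1 0) by ring]

theorem norm_sub_le_of_near {η : ℝ} (hη : 0 ≤ η) (hη4 : η ≤ 1 / 4) {x y v : ℂ}
    (hx : ‖x - v‖ ≤ 2 * η * ‖v‖) (hy : ‖y - v‖ ≤ 2 * η * ‖v‖) : ‖x - y‖ ≤ 8 * η * ‖y‖ := by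
  have h1 := norm_sub_le (x - v) (y - v)
  rw [sub_sub_sub_cancel_right] at h1
  have h2 := norm_sub_norm_le v y
  rw [norm_sub_rev] at h2
  have h3 : ‖v‖ ≤ 2 * ‖y‖ := by nlinarith [norm_nonneg v]
  nlinarith [norm_nonneg v]

open Polynomial unitInterval in
/-- The root curves of a tame family extend to a motion of the plane. -/
theorem exists_motion_of_isTame {W : Type*} [TopologicalSpace W] {η : ℝ} (hη : 0 < η)
    (hη4 : η ≤ 1 / 4) {d : ℕ} {p : I → W → ℂ[X]} (h : ∀ w, IsTame η d fun s => p s w)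
    (hc : ∀ k, Continuous fun y : I × W => (p y.1 y.2).coeff k) :
    ∃ ψ : I → W → ℂ → ℂ, (Continuous fun y : I × W × ℂ => ψ y.1 y.2.1 y.2.2) ∧
      (∀ s w z z', ‖(ψ s w z - z) - (ψ s w z' - z')‖ ≤ 1 / 2 * ‖z - z'‖) ∧
      ∀ w, ∀ b ∈ rootCurves (fun s => p s w), ∀ z, RelClose (8 * η) fun s => ψ s w z - b s := by
  rcases eq_or_ne d 0 with rfl | hd
  · refine ⟨fun _ _ z => z, by fun_prop, by simp, fun w b hb => ?_⟩
    have h1 := hb 0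
    simp [Polynomial.eq_one_of_monic_natDegree_zero ((h w).monic 0) ((h w).natDegree_eq 0)] at h1
  obtain ⟨l₁, hl₁c, hl₁, hl₁b⟩ := exists_mcShane_extension hη.le hd h hc Complex.reCLM
    Complex.abs_re_le_norm
  obtain ⟨l₂, hl₂c, hl₂, hl₂b⟩ := exists_mcShane_extension hη.le hd h hc Complex.imCLM
    Complex.abs_im_le_norm
  have hL : ∀ s w z z', ‖((l₁ s w z : ℂ) + l₂ s w z * Complex.I)
      - ((l₁ s w z' : ℂ) + l₂ s w z' * Complex.I)‖ ≤ 2 * η * ‖z - z'‖ := by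
    intro s w z z'
    have e : ((l₁ s w z : ℂ) + l₂ s w z * Complex.I) - ((l₁ s w z' : ℂ) + l₂ s w z' * Complex.I)
        = ((l₁ s w z - l₁ s w z' : ℝ) : ℂ) + ((l₂ s w z - l₂ s w z' : ℝ) : ℂ) * Complex.I := by
      push_cast; ring
    rw [e]
    refine (norm_add_le _ _).trans ?_
    rw [norm_mul, Complex.norm_I, mul_one, Complex.norm_real, Complex.norm_real]
    have := hl₁ s w z z'
    have := hl₂ s w z z'
    simp only [Real.norm_eq_abs]
    linarith
  refine ⟨fun s w z => z + (l₁ s w z + l₂ s w z * Complex.I), by fun_prop, fun s w z z' => ?_,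
    fun w b hb z => ?_⟩
  · simp only [add_sub_cancel_left]
    refine (hL s w z z').trans ?_
    gcongr
    linarith
  · have hb0 : ∀ s, (l₁ s w (b 0) : ℂ) + l₂ s w (b 0) * Complex.I = b s - b 0 := by
      intro s
      rw [hl₁b s w b hb, hl₂b s w b hb]
      rw [Complex.reCLM_apply, Complex.imCLM_apply, Complex.re_add_im]
    have key : ∀ s, ‖(z + (l₁ s w z + l₂ s w z * Complex.I) - b s) - (z - b 0)‖
        ≤ 2 * η * ‖z - b 0‖ := by
      intro s
      have := hL s w z (b 0)
      rw [hb0] at this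
      refine le_of_eq_of_le (congrArg _ ?_) this
      ring
    exact fun s t => norm_sub_le_of_near hη.le hη4 (key s) (key t)

theorem Multiset.exists_fin_map_eq {α : Type*} (m : Multiset α) {e : ℕ} (h : m.card = e) :
    ∃ v : Fin e → α, (Finset.univ : Finset (Fin e)).val.map v = m := by
  subst h
  induction m using Quotient.inductionOn with
  | h l => exact ⟨l.get, (Fin.univ_val_map l.get).trans (congrArg _ (List.ofFn_get l))⟩

open Polynomial in
theorem map_eq_map_of_prod_sub_eq {e : ℕ} {v v' : Fin e → ℂ}
    (h : ∀ z, ∏ j, (z - v j) = ∏ j, (z - v' j)) :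
    (Finset.univ : Finset (Fin e)).val.map v = (Finset.univ : Finset (Fin e)).val.map v' := by
  have h1 : ∏ j, (Polynomial.X - Polynomial.C (v j)) = ∏ j, (Polynomial.X - Polynomial.C (v' j)) :=
    Polynomial.funext fun z => by simpa [Polynomial.eval_prod] using h z
  have h2 : ∀ v : Fin e → ℂ,
      (∏ j, (Polynomial.X - Polynomial.C (v j))).roots =
        (Finset.univ : Finset (Fin e)).val.map v := fun v => by
    have := Polynomial.roots_multiset_prod_X_sub_C ((Finset.univ : Finset (Fin e)).val.map v)
    rwa [Multiset.map_map] at this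
  rw [← h2, ← h2, h1]

open Polynomial unitInterval in
/-- A monic factor of a tame family is a product of linear factors along root curves. -/
theorem IsTame.exists_factorization {η : ℝ} {d e : ℕ} {p q : I → ℂ[X]} (h : IsTame η d p)
    (hq : ∀ s, (q s).Monic) (hqe : ∀ s, (q s).natDegree = e)
    (hqc : ∀ k, Continuous fun s => (q s).coeff k) (hdvd : ∀ s, q s ∣ p s) :
    ∃ v : Fin e → C(I, ℂ), (∀ j, v j ∈ rootCurves p) ∧
      ∀ s z, (q s).eval z = ∏ j, (z - v j s) := by
  have : Finite (rootCurves p) := h.finite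
  obtain ⟨v, hv⟩ := exists_forall_mem_of_isClosed_cover
    (fun v : Fin e → rootCurves p => {s | ∀ z, (q s).eval z = ∏ j, (z - (v j).1 s)})
    (fun v => by
      simp only [Set.ofPred_forall]
      exact isClosed_iInter fun z => isClosed_eq
        (continuous_eval_of_coeff hqe hqc continuous_const) (by fun_prop))
    (fun s => by
      obtain ⟨a, ha⟩ := Multiset.exists_fin_map_eq (q s).roots (e := e) (by
        rw [← hqe s]; exact (IsAlgClosed.splits _).natDegree_eq_card_roots.symm)
      have h1 : ∀ j, ∃ b : rootCurves p, b.1 s = a j := fun j => by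
        have h2 : a j ∈ (q s).roots := by
          rw [← ha]; exact Multiset.mem_map_of_mem _ (Finset.mem_univ_val j)
        obtain ⟨b, hb, hb'⟩ := h.exists_curve s (a j)
          (Polynomial.eval_eq_zero_of_dvd_of_eval_eq_zero (hdvd s)
            (Polynomial.isRoot_of_mem_roots h2))
        exact ⟨⟨b, hb⟩, hb'⟩
      choose b hb using h1
      refine ⟨b, fun z => ?_⟩
      rw [monic_eval_eq_prod_roots (hq s), ← ha, Multiset.map_map]
      exact Finset.prod_congr rfl fun j _ => by simp [hb])
    (fun s v v' hs hs' => by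
      have h1 : (Finset.univ : Finset (Fin e)).val.map (fun j => (v j).1 s)
          = (Finset.univ : Finset (Fin e)).val.map (fun j => (v' j).1 s) :=
        map_eq_map_of_prod_sub_eq fun z => (hs z).symm.trans (hs' z)
      have h2 : (Finset.univ : Finset (Fin e)).val.map v
          = (Finset.univ : Finset (Fin e)).val.map v' := by
        refine Multiset.map_injective (f := fun b : rootCurves p => b.1 s)
          (fun b b' hbb => Subtype.ext (h.eq_of_apply_eq b.2 b'.2 hbb)) ?_
        simpa only [Multiset.map_map, Function.comp_def] using h1
      have h3 : ∀ t z, ∏ j, (z - (v j).1 t) = ∏ j, (z - (v' j).1 t) := fun t z => by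
        have := congrArg (fun m => (m.map fun b : rootCurves p => z - b.1 t).prod) h2
        rw [Multiset.map_map, Multiset.map_map] at this
        exact this
      simp only [h3])
  exact ⟨fun j => (v j).1, fun j => (v j).2, hv⟩

open Polynomial unitInterval in
/-- Extension of the motion of the roots of a polynomial whose difference polynomial has relatively
close coefficients, such that all factors of the polynomial stay relatively close. -/
theorem exists_motion.{u} (d N : ℕ) {ε : ℝ} (hε : 0 < ε) : ∃ δ : ℝ, 0 < δ ∧
    ∀ (W : Type u) [TopologicalSpace W] (p q : I → W → ℂ[X]),
    (∀ s w, (p s w).Monic) → (∀ s w, (p s w).natDegree = d) →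
    (∀ k, Continuous fun y : I × W => (p y.1 y.2).coeff k) → (∀ s w, (q s w).Monic) →
    (∀ s w, (q s w).natDegree = N) → (∀ k w, RelClose δ fun s => (q s w).coeff k) →
    (∀ s w a b, (p s w).eval a = 0 → (p s w).eval b = 0 → (q s w).eval (a - b) = 0) →
    ∃ ψ : I → W → ℂ → ℂ, (Continuous fun y : I × W × ℂ => ψ y.1 y.2.1 y.2.2) ∧
      (∀ s w z z', ‖(ψ s w z - z) - (ψ s w z' - z')‖ ≤ 1 / 2 * ‖z - z'‖) ∧
      ∀ w (e : ℕ) (f : I → ℂ[X]), (∀ s, (f s).Monic) → (∀ s, (f s).natDegree = e) →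
        (∀ k, Continuous fun s => (f s).coeff k) → (∀ s, f s ∣ p s w) →
        ∀ z, RelClose ε fun s => (f s).eval (ψ s w z) := by
  obtain ⟨η', hη', hη'ε⟩ := exists_pos_one_add_pow_sub_one_le d hε
  obtain ⟨δ, hδ, H⟩ := exists_isTame d N (η := min (η' / 8) (1 / 4)) (by positivity)
  refine ⟨δ, hδ, fun W _ p q hp hpd hpc hq hqd hqc hpq => ?_⟩
  have htame : ∀ w, IsTame (min (η' / 8) (1 / 4)) d fun s => p s w := fun w =>
    H (fun s => p s w) (fun s => q s w) (fun s => hp s w) (fun s => hpd s w)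
      (fun k => (hpc k).comp (f := fun s => (s, w)) (by fun_prop)) (fun s => hq s w)
      (fun s => hqd s w) (fun k => hqc k w) (fun s => hpq s w)
  obtain ⟨ψ, hψ, hψ', hψr⟩ := exists_motion_of_isTame (by positivity) (min_le_right _ _) htame hpc
  refine ⟨ψ, hψ, hψ', fun w e f hf hfe hfc hfp z => ?_⟩
  obtain ⟨v, hv, hfv⟩ := (htame w).exists_factorization hf hfe hfc hfp
  have hed : e ≤ d := by
    rw [← hfe 0, ← hpd 0 w]
    exact Polynomial.natDegree_le_of_dvd (hfp 0) (hp 0 w).ne_zero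
  have h1 : RelClose ((1 + η') ^ e - 1) fun s => ∏ j, (ψ s w z - v j s) := by
    simpa using RelClose.prod (F := Finset.univ) hη'.le fun j _ =>
      (hψr w (v j) (hv j) z).mono (by linarith [min_le_left (η' / 8) (1 / 4)])
  simp only [hfv]
  refine h1.mono (le_trans ?_ hη'ε)
  gcongr
  linarith

/-- A continuous family of perturbations of the identity of `ℂ` with Lipschitz constant `1 / 2`
is a fibrewise homeomorphism. -/
theorem exists_homeomorph_of_perturbation {W : Type*} [TopologicalSpace W] {ψ : W → ℂ → ℂ}
    (hψ : Continuous fun y : W × ℂ => ψ y.1 y.2)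
    (hψ' : ∀ w z z', ‖(ψ w z - z) - (ψ w z' - z')‖ ≤ 1 / 2 * ‖z - z'‖) :
    ∃ h : W × ℂ ≃ₜ W × ℂ, ∀ y, h y = (y.1, ψ y.1 y.2) := by
  have hexp : ∀ w z z', ‖z - z'‖ ≤ 2 * ‖ψ w z - ψ w z'‖ := fun w z z' => by
    have h1 := hψ' w z z'
    have h2 := norm_sub_le (ψ w z - ψ w z') ((ψ w z - z) - (ψ w z' - z'))
    rw [show ψ w z - ψ w z' - (ψ w z - z - (ψ w z' - z')) = z - z' by ring] at h2
    linarith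
  have hsurj : ∀ w y, ∃ z, ψ w z = y := fun w y => by
    have hcon : ContractingWith (1 / 2) fun z => y - (ψ w z - z) := by
      refine ⟨by norm_num, LipschitzWith.of_dist_le_mul fun z z' => ?_⟩
      rw [dist_eq_norm, dist_eq_norm, sub_sub_sub_cancel_left, norm_sub_rev]
      exact_mod_cast hψ' w z z'
    have h1 : y - (ψ w (ContractingWith.fixedPoint _ hcon) - ContractingWith.fixedPoint _ hcon)
        = ContractingWith.fixedPoint _ hcon := hcon.fixedPoint_isFixedPt
    exact ⟨ContractingWith.fixedPoint _ hcon, by linear_combination -h1⟩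
  choose θ hθ using hsurj
  have hθ' : ∀ w z, θ w (ψ w z) = z := fun w z => by
    have h1 := hexp w (θ w (ψ w z)) z
    rw [hθ, sub_self, norm_zero, mul_zero] at h1
    exact sub_eq_zero.mp (norm_le_zero_iff.mp h1)
  have hcont : Continuous fun y : W × ℂ => θ y.1 y.2 := by
    rw [continuous_iff_continuousAt]
    rintro ⟨w₀, y₀⟩
    rw [ContinuousAt, tendsto_iff_norm_sub_tendsto_zero]
    have h1 : Continuous fun y : W × ℂ => 2 * ‖y.2 - ψ y.1 (θ w₀ y₀)‖ := by
      have := hψ.comp (f := fun y : W × ℂ => (y.1, θ w₀ y₀)) (by fun_prop)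
      have h2 : Continuous fun y : W × ℂ => ψ y.1 (θ w₀ y₀) := this
      fun_prop
    have h2 := h1.tendsto (w₀, y₀)
    simp only [hθ, sub_self, norm_zero, mul_zero] at h2
    refine squeeze_zero (fun _ => norm_nonneg _) (fun y => ?_) h2
    have := hexp y.1 (θ y.1 y.2) (θ w₀ y₀)
    rwa [hθ] at this
  exact ⟨{ toFun := fun y => (y.1, ψ y.1 y.2)
           invFun := fun y => (y.1, θ y.1 y.2)
           left_inv := fun y => by simp [hθ']
           right_inv := fun y => by simp [hθ]
           continuous_toFun := continuous_fst.prodMk hψ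
           continuous_invFun := continuous_fst.prodMk hcont }, fun _ => rfl⟩

open Polynomial in
/-- For every polynomial `P` there is a monic polynomial annihilating, under every specialisation,
the differences of the roots of `P` multiplied by its leading coefficient. -/
theorem exists_difference_polynomial {A : Type*} [CommRing A] (P : A[X]) :
    ∃ Q : A[X], Q.Monic ∧ ∀ (e : A →+* ℂ) (a b : ℂ), (P.map e).eval a = 0 →
      (P.map e).eval b = 0 → (Q.map e).eval (e P.leadingCoeff * (a - b)) = 0 := by
  let x : Fin 2 → MvPolynomial (Fin 2) A := MvPolynomial.X
  let J : Ideal (MvPolynomial (Fin 2) A) := Ideal.span (Set.range fun i => aeval (x i) P)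
  have hint : ∀ i, IsIntegral A (P.leadingCoeff • Ideal.Quotient.mkₐ A J (x i)) := fun i => by
    refine isIntegral_leadingCoeff_smul P _ ?_
    rw [Polynomial.aeval_algHom_apply]
    exact Ideal.Quotient.eq_zero_iff_mem.mpr (Ideal.subset_span ⟨i, rfl⟩)
  obtain ⟨Q, hQ, hQ'⟩ := (hint 0).sub (hint 1)
  refine ⟨Q, hQ, fun e a b ha hb => ?_⟩
  let φ : MvPolynomial (Fin 2) A →+* ℂ := MvPolynomial.eval₂Hom e ![a, b]
  have hφ : ∀ c, φ (MvPolynomial.C c) = e c := fun c => by simp [φ]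
  have hJ : ∀ c ∈ J, φ c = 0 := by
    intro c hc
    refine Submodule.span_induction ?_ (map_zero φ) (fun c c' _ _ h h' => by rw [map_add, h, h',
      add_zero]) (fun r c _ h => by rw [smul_eq_mul, map_mul, h, mul_zero]) hc
    rintro _ ⟨i, rfl⟩
    change φ (Polynomial.aeval (x i) P) = 0
    rw [Polynomial.aeval_def, Polynomial.hom_eval₂]
    have h1 : φ.comp (algebraMap A (MvPolynomial (Fin 2) A)) = e := by
      ext c; exact hφ c
    rw [h1, Polynomial.eval₂_eq_eval_map]
    fin_cases i
    · simpa [φ, x] using ha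
    · simpa [φ, x] using hb
  let Φ : MvPolynomial (Fin 2) A ⧸ J →+* ℂ := Ideal.Quotient.lift J φ hJ
  have h1 := congrArg Φ hQ'
  rw [Polynomial.hom_eval₂, map_zero] at h1
  have h2 : Φ.comp (algebraMap A (MvPolynomial (Fin 2) A ⧸ J)) = e := by
    ext c; exact hφ c
  have h3 : ∀ i, Φ (P.leadingCoeff • Ideal.Quotient.mkₐ A J (x i))
      = e P.leadingCoeff * ![a, b] i := fun i => by
    rw [← map_smul]
    change φ (P.leadingCoeff • x i) = _
    rw [MvPolynomial.smul_eq_C_mul, map_mul, hφ]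
    simp [φ, x]
  rw [h2, map_sub, h3, h3, ← mul_sub] at h1
  rw [← Polynomial.eval₂_eq_eval_map]
  exact h1

open unitInterval in
/-- A family of functions `c t : X → ℂ` depending on a parameter `t` is controlled near `t₀` if
along every path of parameters near `t₀` there is an isotopy of `X`, compatible with the
projection `π`, along which all functions of the family stay relatively close. -/
def IsControlled {X Y T : Type*} [TopologicalSpace X] [TopologicalSpace Y] [TopologicalSpace T]
    (π : X → Y) (t₀ : T) (G : Set (T → X → ℂ)) : Prop :=
  ∀ ε : ℝ, 0 < ε → ∃ N ∈ nhds t₀, ∀ γ : C(I, T), (∀ s, γ s ∈ N) →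
    ∃ (h : I → X ≃ₜ X) (g : I → Y ≃ₜ Y), (Continuous fun y : I × X => h y.1 y.2) ∧
      (∀ s x, π (h s x) = g s (π x)) ∧ ∀ c ∈ G, ∀ x, RelClose ε fun s => c (γ s) (h s x)

theorem exists_nhds_relClose {T : Type*} [TopologicalSpace T] {c : T → ℂ} (hc : Continuous c)
    {t₀ : T} (h₀ : c t₀ ≠ 0) {δ : ℝ} (hδ : 0 < δ) :
    ∃ N ∈ nhds t₀, ∀ t ∈ N, c t ≠ 0 ∧ ∀ t' ∈ N, ‖c t - c t'‖ ≤ δ * ‖c t'‖ := by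
  have hpos := norm_pos_iff.mpr h₀
  refine ⟨{t | ‖c t₀‖ / 2 < ‖c t‖ ∧ ‖c t - c t₀‖ < δ * ‖c t₀‖ / 4}, ?_, fun t ht => ⟨?_, ?_⟩⟩
  · refine Filter.inter_mem ?_ ?_
    · exact continuousAt_const.eventually_lt hc.norm.continuousAt (half_lt_self hpos)
    · refine (hc.sub continuous_const).norm.continuousAt.eventually_lt continuousAt_const ?_
      simp only [Pi.sub_apply, sub_self, norm_zero]
      positivity
  · rw [← norm_pos_iff]; linarith [ht.1]
  · intro t' ht'
    have h1 := norm_sub_le (c t - c t₀) (c t' - c t₀)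
    rw [sub_sub_sub_cancel_right] at h1
    have := ht.2
    have := ht'.2
    nlinarith [ht'.1]

namespace IsControlled

variable {X Y T : Type*} [TopologicalSpace X] [TopologicalSpace Y] [TopologicalSpace T]
  {π : X → Y} {t₀ : T} {G : Set (T → X → ℂ)}

theorem mono {G' : Set (T → X → ℂ)} (h : IsControlled π t₀ G) (hG : G' ⊆ G) :
    IsControlled π t₀ G' := fun ε hε => by
  obtain ⟨N, hN, H⟩ := h ε hε
  refine ⟨N, hN, fun γ hγ => ?_⟩
  obtain ⟨h, g, h1, h2, h3⟩ := H γ hγ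
  exact ⟨h, g, h1, h2, fun c hc => h3 c (hG hc)⟩

open unitInterval in
/-- Transport of controlled families along a homeomorphism. -/
theorem congr {X' : Type*} [TopologicalSpace X'] (h : IsControlled π t₀ G) (e : X' ≃ₜ X)
    {G' : Set (T → X' → ℂ)} (hG : ∀ c ∈ G', (fun t x => c t (e.symm x)) ∈ G) :
    IsControlled (π ∘ e) t₀ G' := fun ε hε => by
  obtain ⟨N, hN, H⟩ := h ε hε
  refine ⟨N, hN, fun γ hγ => ?_⟩
  obtain ⟨h, g, h1, h2, h3⟩ := H γ hγ
  refine ⟨fun s => (e.trans (h s)).trans e.symm, g, ?_, fun s x => ?_, fun c hc x => ?_⟩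
  · have : Continuous fun y : I × X' => e.symm (h y.1 (e y.2)) :=
      e.symm.continuous.comp (h1.comp (by fun_prop : Continuous fun y : I × X' => (y.1, e y.2)))
    exact this
  · simp [h2]
  · exact h3 _ (hG c hc) (e x)

open Polynomial unitInterval in
/-- A finite family of polynomials is controlled if the coefficients of the difference polynomial
of its product are. -/
theorem step {A : Type*} [CommRing A] [IsDomain A] {ev : T → X → A →+* ℂ}
    (hev : ∀ a, Continuous fun y : T × X => ev y.1 y.2 a) (H : Finset A[X])
    {lc : A[X] → T → ℂ} (hlc : ∀ c ∈ H, Continuous (lc c)) (hlc₀ : ∀ c ∈ H, lc c t₀ ≠ 0)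
    (hlc' : ∀ c ∈ H, ∀ t x, ev t x c.leadingCoeff = lc c t) {q : A[X]} (hq : q.Monic)
    (hq' : ∀ (e : A →+* ℂ) (a b : ℂ), ((∏ c ∈ H, c).map e).eval a = 0 →
      ((∏ c ∈ H, c).map e).eval b = 0 →
      (q.map e).eval (e (∏ c ∈ H, c).leadingCoeff * (a - b)) = 0)
    (hctrl : IsControlled π t₀ (Set.range fun k t x => ev t x (q.coeff k))) :
    IsControlled (π ∘ Prod.fst : X × ℂ → Y) t₀
      ((fun c t y => (c.map (ev t y.1)).eval y.2) '' (H : Set A[X])) := by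
  intro ε hε
  set P := ∏ c ∈ H, c with hP
  set d := P.natDegree with hd
  set n := q.natDegree with hn
  obtain ⟨ε₁, hε₁, hε₁'⟩ := exists_pos_one_add_pow_sub_one_le 2 hε
  obtain ⟨δ, hδ, hmot⟩ := exists_motion d n hε₁
  obtain ⟨δ₁, hδ₁, hδ₁'⟩ := exists_pos_one_add_pow_sub_one_le (n + 1) hδ
  obtain ⟨N, hN, hctrl⟩ := hctrl δ₁ hδ₁
  have hPlc : ∀ t x, ev t x P.leadingCoeff = ∏ c ∈ H, lc c t := fun t x => by
    rw [hP, Polynomial.leadingCoeff_prod, map_prod]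
    exact Finset.prod_congr rfl fun c hc => hlc' c hc t x
  have hσc : Continuous fun t => ∏ c ∈ H, lc c t := continuous_finsetProd _ hlc
  obtain ⟨N₁, hN₁, hσ⟩ := exists_nhds_relClose hσc (Finset.prod_ne_zero_iff.mpr hlc₀) hδ₁
  have h1 : ∃ N₂ ∈ nhds t₀, ∀ c ∈ H, ∀ t ∈ N₂, lc c t ≠ 0 ∧
      ∀ t' ∈ N₂, ‖lc c t - lc c t'‖ ≤ ε₁ * ‖lc c t'‖ := by
    choose! V hV hV' using fun c (hc : c ∈ H) => exists_nhds_relClose (hlc c hc) (hlc₀ c hc) hε₁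
    refine ⟨⋂ c ∈ H, V c, (Filter.biInter_finset_mem H).mpr hV, fun c hc t ht => ?_⟩
    have hsub : ∀ t ∈ ⋂ c ∈ H, V c, t ∈ V c := fun t ht => by
      simp only [Set.mem_iInter] at ht; exact ht c hc
    exact ⟨(hV' c hc t (hsub t ht)).1, fun t' ht' => (hV' c hc t (hsub t ht)).2 t' (hsub t' ht')⟩
  obtain ⟨N₂, hN₂, hlcN⟩ := h1
  refine ⟨N ∩ N₁ ∩ N₂, Filter.inter_mem (Filter.inter_mem hN hN₁) hN₂, fun γ hγ => ?_⟩
  obtain ⟨h, g, hh, hg, hrel⟩ := hctrl γ fun s => (hγ s).1.1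
  set τ : I → ℂ := fun s => ∏ c ∈ H, lc c (γ s) with hτ
  have hτ0 : ∀ s, τ s ≠ 0 := fun s => (hσ _ (hγ s).1.2).1
  have hτc : Continuous τ := hσc.comp γ.continuous
  have hτrel : RelClose δ₁ τ := fun s t => (hσ _ (hγ s).1.2).2 _ (hγ t).1.2
  have hevc : ∀ a, Continuous fun y : I × X => ev (γ y.1) (h y.1 y.2) a := fun a =>
    (hev a).comp (f := fun y : I × X => (γ y.1, h y.1 y.2)) (by fun_prop)
  -- normalisation of polynomials with nonvanishing leading coefficient
  have hnorm : ∀ (f : A[X]) (c : ℂ) (s : I) (x : X), ev (γ s) (h s x) f.leadingCoeff = c → c ≠ 0 →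
      (Polynomial.C c⁻¹ * f.map (ev (γ s) (h s x))).Monic ∧
      (Polynomial.C c⁻¹ * f.map (ev (γ s) (h s x))).natDegree = f.natDegree := by
    intro f c s x hc hc0
    have hc1 : ev (γ s) (h s x) f.leadingCoeff ≠ 0 := by rwa [hc]
    constructor
    · rw [Polynomial.Monic, Polynomial.leadingCoeff_mul, Polynomial.leadingCoeff_C,
        Polynomial.leadingCoeff_map_of_leadingCoeff_ne_zero _ hc1, hc, inv_mul_cancel₀ hc0]
    · rw [Polynomial.natDegree_C_mul (inv_ne_zero hc0),
        Polynomial.natDegree_map_of_leadingCoeff_ne_zero _ hc1]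
  obtain ⟨ψ, hψ, hψ', hψrel⟩ := hmot X
    (fun s x => Polynomial.C (τ s)⁻¹ * P.map (ev (γ s) (h s x)))
    (fun s x => scaleRoots (q.map (ev (γ s) (h s x))) (τ s)⁻¹)
    (fun s x => (hnorm P (τ s) s x (hPlc _ _) (hτ0 s)).1)
    (fun s x => (hnorm P (τ s) s x (hPlc _ _) (hτ0 s)).2)
    (fun k => by
      simp only [Polynomial.coeff_C_mul, Polynomial.coeff_map]
      exact ((hτc.comp continuous_fst).inv₀ fun y => hτ0 y.1).mul (hevc _))
    (fun s x => (Polynomial.monic_scaleRoots_iff _).mpr (hq.map _))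
    (fun s x => by rw [Polynomial.natDegree_scaleRoots, hq.natDegree_map])
    (fun k x => by
      simp only [Polynomial.coeff_scaleRoots, Polynomial.coeff_map, hq.natDegree_map]
      have h2 := ((hrel _ ⟨k, rfl⟩ x).mul (hτrel.inv.pow hδ₁.le (n - k)) hδ₁.le)
      refine h2.mono (le_trans ?_ hδ₁')
      have h3 : (1 + δ₁) ^ (n - k) ≤ (1 + δ₁) ^ n :=
        pow_le_pow_right₀ (by linarith) (Nat.sub_le n k)
      rw [pow_succ]
      nlinarith)
    (fun s x a b ha hb => by
      rw [Polynomial.eval_mul, Polynomial.eval_C] at ha hb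
      have ha' := (mul_eq_zero.mp ha).resolve_left (inv_ne_zero (hτ0 s))
      have hb' := (mul_eq_zero.mp hb).resolve_left (inv_ne_zero (hτ0 s))
      have h2 := hq' _ a b ha' hb'
      rw [hPlc] at h2
      have h3 := Polynomial.scaleRoots_eval_mul (q.map (ev (γ s) (h s x))) (τ s * (a - b)) (τ s)⁻¹
      rw [h2, mul_zero, ← mul_assoc, inv_mul_cancel₀ (hτ0 s), one_mul] at h3
      exact h3)
  choose k hk using fun s => exists_homeomorph_of_perturbation (ψ := ψ s)
    (hψ.comp (f := fun y : X × ℂ => (s, y)) (by fun_prop)) (hψ' s)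
  refine ⟨fun s => (k s).trans ((h s).prodCongr (Homeomorph.refl ℂ)), g, ?_, fun s y => ?_, ?_⟩
  · have h2 : Continuous fun y : I × X × ℂ => (h y.1 y.2.1, ψ y.1 y.2.1 y.2.2) :=
      (hh.comp (f := fun y : I × X × ℂ => (y.1, y.2.1)) (by fun_prop)).prodMk hψ
    refine h2.congr fun y => ?_
    simp [hk]
  · simp [hk, hg]
  · rintro _ ⟨c, hc, rfl⟩ ⟨x, z⟩
    have hc' : c ∈ H := hc
    have hlc0 : ∀ s, lc c (γ s) ≠ 0 := fun s => (hlcN c hc' _ (hγ s).2).1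
    have h2 := hψrel x c.natDegree (fun s => Polynomial.C (lc c (γ s))⁻¹ * c.map (ev (γ s) (h s x)))
      (fun s => (hnorm c _ s x (hlc' c hc' _ _) (hlc0 s)).1)
      (fun s => (hnorm c _ s x (hlc' c hc' _ _) (hlc0 s)).2)
      (fun k => by
        simp only [Polynomial.coeff_C_mul, Polynomial.coeff_map]
        exact (((hlc c hc').comp γ.continuous).inv₀ hlc0).mul
          ((hevc _).comp (f := fun s => (s, x)) (by fun_prop)))
      (fun s => by
        obtain ⟨r, hr⟩ : c.map (ev (γ s) (h s x)) ∣ P.map (ev (γ s) (h s x)) :=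
          Polynomial.map_dvd _ (Finset.dvd_prod_of_mem _ hc')
        refine ⟨Polynomial.C (lc c (γ s)) * Polynomial.C (τ s)⁻¹ * r, ?_⟩
        have h4 : Polynomial.C (lc c (γ s))⁻¹ * Polynomial.C (lc c (γ s)) = 1 := by
          rw [← Polynomial.C_mul, inv_mul_cancel₀ (hlc0 s), Polynomial.C_1]
        rw [hr]
        linear_combination (-(Polynomial.C (τ s)⁻¹ * c.map (ev (γ s) (h s x)) * r)) * h4) z
    have h3 : RelClose ε₁ fun s => lc c (γ s) := fun s t =>
      (hlcN c hc' _ (hγ s).2).2 _ (hγ t).2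
    have h4 := h3.mul h2 hε₁.le
    have h5 : ∀ s, (c.map (ev (γ s) ((((k s).trans ((h s).prodCongr (Homeomorph.refl ℂ)))
        (x, z)).1))).eval (((k s).trans ((h s).prodCongr (Homeomorph.refl ℂ))) (x, z)).2
        = lc c (γ s) * (Polynomial.C (lc c (γ s))⁻¹ * c.map (ev (γ s) (h s x))).eval (ψ s x z) := by
      intro s
      rw [Polynomial.eval_mul, Polynomial.eval_C, mul_inv_cancel_left₀ (hlc0 s)]
      simp [hk]
    simp only [h5]
    refine h4.mono (le_trans (le_of_eq ?_) hε₁')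
    ring

end IsControlled

/-- A family of functions on `X`, depending on a point `t` of an affine space and indexed by `A`,
is generically controlled if each of its finite subfamilies is controlled near the general `t`. -/
def IsGenericallyControlled {ι A X Y : Type*} [TopologicalSpace X] [TopologicalSpace Y]
    (π : X → Y) (f : A → (ι → ℂ) → X → ℂ) : Prop :=
  ∀ G : Finset A, ∃ s : MvPolynomial ι ℂ, s ≠ 0 ∧
    ∀ t, eval t s ≠ 0 → IsControlled π t (f '' (G : Set A))

open Polynomial in
theorem exists_isControlled_of_leadingCoeff {ι A X Y : Type*} [TopologicalSpace X]
    [TopologicalSpace Y] {π : X → Y} [CommRing A] [IsDomain A] {ev : (ι → ℂ) → X → A →+* ℂ}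
    (hev : ∀ a, Continuous fun y : (ι → ℂ) × X => ev y.1 y.2 a)
    (hctrl : IsGenericallyControlled π fun a t x => ev t x a) (H : Finset A[X])
    (hH : ∀ c ∈ H, c ≠ 0 → ∃ r : MvPolynomial ι ℂ, r ≠ 0 ∧
      ∀ t x, ev t x c.leadingCoeff = eval t r) :
    ∃ s : MvPolynomial ι ℂ, s ≠ 0 ∧ ∀ t, eval t s ≠ 0 →
      IsControlled (π ∘ Prod.fst : X × ℂ → Y) t
        ((fun c t y => (c.map (ev t y.1)).eval y.2) '' (H : Set A[X])) := by
  classical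
  set H' := H.filter (· ≠ 0) with hH'
  choose! r hr₀ hr using hH
  have hmem : ∀ c ∈ H', c ∈ H ∧ c ≠ 0 := fun c hc => Finset.mem_filter.mp hc
  obtain ⟨q, hq, hq'⟩ := exists_difference_polynomial (∏ c ∈ H', c)
  obtain ⟨s, hs, hs'⟩ := hctrl (insert 0 q.coeffs)
  refine ⟨s * ∏ c ∈ H', r c, mul_ne_zero hs (Finset.prod_ne_zero_iff.mpr fun c hc =>
    hr₀ c (hmem c hc).1 (hmem c hc).2), fun t ht => ?_⟩
  rw [map_mul, map_prod] at ht
  have h1 := Finset.prod_ne_zero_iff.mp (right_ne_zero_of_mul ht)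
  have h2 := IsControlled.step (π := π) (t₀ := t) hev H' (lc := fun c t => eval t (r c))
    (fun c _ => MvPolynomial.continuous_eval (r c)) h1
    (fun c hc t x => hr c (hmem c hc).1 (hmem c hc).2 t x) hq hq'
    ((hs' t (left_ne_zero_of_mul ht)).mono (by
      rintro _ ⟨k, rfl⟩
      refine ⟨q.coeff k, ?_, rfl⟩
      by_cases hk : q.coeff k = 0
      · simp [hk]
      · exact Finset.mem_coe.mpr (Finset.mem_insert_of_mem
          (Polynomial.coeff_mem_coeffs hk))))
  intro ε hε
  obtain ⟨N, hN, hN'⟩ := h2 ε hε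
  refine ⟨N, hN, fun γ hγ => ?_⟩
  obtain ⟨h, g, hh, hg, hrel⟩ := hN' γ hγ
  refine ⟨h, g, hh, hg, ?_⟩
  rintro _ ⟨c, hc, rfl⟩ x
  by_cases hc0 : c = 0
  · intro s t
    simp [hc0]
  · exact hrel _ ⟨c, Finset.mem_filter.mpr ⟨hc, hc0⟩, rfl⟩ x

open Polynomial in
theorem exists_leadingCoeff_sum_eq {A S : Type*} [CommRing A] {s : Finset S} (hs : s.Nonempty)
    {a : S → A} (ha : ∀ v ∈ s, a v ≠ 0) {p : S → A[X]} (hp : ∀ v ∈ s, (p v).Monic)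
    (hd : ∀ v ∈ s, ∀ w ∈ s, v ≠ w → (p v).natDegree ≠ (p w).natDegree) :
    ∃ v ∈ s, (∑ v ∈ s, Polynomial.C (a v) * p v).leadingCoeff = a v := by
  obtain ⟨v, hv, hmax⟩ := s.exists_max_image (fun v => (p v).natDegree) hs
  have h1 : (∑ v ∈ s, Polynomial.C (a v) * p v).coeff (p v).natDegree = a v := by
    rw [Polynomial.finsetSum_coeff, Finset.sum_eq_single_of_mem v hv]
    · rw [Polynomial.coeff_C_mul, (hp v hv).coeff_natDegree, mul_one]
    · intro w hw hwv
      rw [Polynomial.coeff_C_mul, Polynomial.coeff_eq_zero_of_natDegree_lt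
        (lt_of_le_of_ne (hmax w hw) (hd w hw v hv hwv)), mul_zero]
  have h2 : (∑ v ∈ s, Polynomial.C (a v) * p v).natDegree = (p v).natDegree := by
    refine le_antisymm ?_ (Polynomial.le_natDegree_of_ne_zero (h1 ▸ ha v hv))
    exact Polynomial.natDegree_sum_le_of_forall_le _ _ fun w hw =>
      (Polynomial.natDegree_C_mul_le _ _).trans (hmax w hw)
  exact ⟨v, hv, by rw [Polynomial.leadingCoeff, h2, h1]⟩

open Polynomial in
/-- The substitution of the Noether normalisation lemma, in the form of a map to polynomials in one
distinguished variable. -/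
noncomputable def nagataSubst (R : Type*) [CommRing R] (N M : ℕ) :
    MvPolynomial (Fin (M + 1)) R →ₐ[R] (MvPolynomial (Fin M) R)[X] :=
  MvPolynomial.aeval (Fin.cons Polynomial.X fun i : Fin M =>
    Polynomial.X ^ N ^ (i.val + 1) + Polynomial.C (MvPolynomial.X i))

open Polynomial in
theorem eval_map_nagataSubst {R : Type*} [CommRing R] (N M : ℕ) (e : R →+* ℂ)
    (c : MvPolynomial (Fin (M + 1)) R) (x : Fin M → ℂ) (z : ℂ) :
    ((nagataSubst R N M c).map (eval₂Hom e x)).eval z =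
      eval₂Hom e (Fin.cons z fun i : Fin M => z ^ N ^ (i.val + 1) + x i) c := by
  have h : ((Polynomial.evalRingHom z).comp (Polynomial.mapRingHom (eval₂Hom e x))).comp
      (nagataSubst R N M : MvPolynomial (Fin (M + 1)) R →+* (MvPolynomial (Fin M) R)[X]) =
      eval₂Hom e (Fin.cons z fun i : Fin M => z ^ N ^ (i.val + 1) + x i) := by
    refine MvPolynomial.ringHom_ext (fun r => ?_) fun i => ?_
    · simp [nagataSubst, MvPolynomial.algebraMap_eq, Polynomial.algebraMap_apply]
    · refine Fin.cases ?_ (fun i => ?_) i <;> simp [nagataSubst]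
  exact RingHom.congr_fun h c

open Polynomial in
theorem exists_leadingCoeff_nagataSubst {R : Type*} [CommRing R] [IsDomain R] {N M : ℕ}
    (hN : 1 < N) {c : MvPolynomial (Fin (M + 1)) R} (hc : c ≠ 0) (hcN : c.totalDegree < N) :
    ∃ r : R, r ≠ 0 ∧ (nagataSubst R N M c).leadingCoeff = MvPolynomial.C r := by
  set x : Fin (M + 1) → (MvPolynomial (Fin M) R)[X] := Fin.cons Polynomial.X fun i : Fin M =>
    Polynomial.X ^ N ^ (i.val + 1) + Polynomial.C (MvPolynomial.X i) with hx
  have hxm : ∀ i, (x i).Monic ∧ (x i).natDegree = N ^ i.val := fun i => by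
    refine Fin.cases ?_ (fun i => ?_) i
    · simp [hx, Polynomial.monic_X]
    · have : N ^ (i.val + 1) ≠ 0 := pow_ne_zero _ (by omega)
      simp [hx, Polynomial.monic_X_pow_add_C _ this]
  have hpm : ∀ v : Fin (M + 1) →₀ ℕ, (∏ i, x i ^ v i).Monic := fun v =>
    Polynomial.monic_prod_of_monic _ _ fun i _ => (hxm i).1.pow _
  have hpd : ∀ v : Fin (M + 1) →₀ ℕ, (∏ i, x i ^ v i).natDegree = ∑ i, N ^ i.val * v i := fun v => by
    rw [Polynomial.natDegree_prod_of_monic _ _ fun i _ => (hxm i).1.pow _]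
    refine Finset.sum_congr rfl fun i _ => ?_
    rw [(hxm i).1.natDegree_pow, (hxm i).2, mul_comm]
  have hlt : ∀ v ∈ c.support, ∀ i, v i < N := fun v hv i =>
    ((monomial_le_degreeOf i hv).trans (degreeOf_le_totalDegree c i)).trans_lt hcN
  have hsum : nagataSubst R N M c =
      ∑ v ∈ c.support, Polynomial.C (MvPolynomial.C (coeff v c)) * ∏ i, x i ^ v i := by
    rw [nagataSubst, MvPolynomial.aeval_def, MvPolynomial.eval₂_eq']
    rfl
  obtain ⟨v, hv, hv'⟩ := exists_leadingCoeff_sum_eq (s := c.support)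
    (a := fun v => MvPolynomial.C (σ := Fin M) (coeff v c)) (p := fun v => ∏ i, x i ^ v i)
    (support_nonempty.mpr hc)
    (fun v hv => (MvPolynomial.C_ne_zero (σ := Fin M)).mpr (mem_support_iff.mp hv))
    (fun v _ => hpm v) (fun v hv w hw hvw h => by
      rw [hpd, hpd] at h
      refine hvw (Finsupp.ext (congrFun (List.ofFn_inj.mp ?_)))
      refine Nat.ofDigits_inj_of_len_eq hN (by simp) ?_ ?_ ?_
      · intro l hl
        obtain ⟨i, rfl⟩ := (List.mem_ofFn' _ _).mp hl
        exact hlt v hv i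
      · intro l hl
        obtain ⟨i, rfl⟩ := (List.mem_ofFn' _ _).mp hl
        exact hlt w hw i
      · simpa only [Nat.ofDigits_eq_sum_mapIdx, List.mapIdx_eq_ofFn, List.get_ofFn,
          List.length_ofFn, Fin.val_cast, mul_comm, List.sum_ofFn] using! h)
  exact ⟨coeff v c, mem_support_iff.mp hv, by rw [hsum, hv']⟩

/-- The shear of affine space underlying `nagataSubst`. -/
def nagataShear (N M : ℕ) : (Fin (M + 1) → ℂ) ≃ₜ (Fin M → ℂ) × ℂ where
  toFun x := (fun i => x i.succ - x 0 ^ N ^ (i.val + 1), x 0)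
  invFun y := Fin.cons y.2 fun i : Fin M => y.2 ^ N ^ (i.val + 1) + y.1 i
  left_inv x := by
    funext i
    refine Fin.cases ?_ (fun i => ?_) i <;> simp
  right_inv y := by simp
  continuous_toFun := by fun_prop
  continuous_invFun := by
    refine continuous_pi fun i => ?_
    refine Fin.cases ?_ (fun i => ?_) i
    · simpa using continuous_snd
    · simp only [Fin.cons_succ]; fun_prop

theorem continuous_eval₂Hom_eval {ι κ : Type*} [Finite κ] (c : MvPolynomial κ (MvPolynomial ι ℂ)) :
    Continuous fun y : (ι → ℂ) × (κ → ℂ) => eval₂Hom (eval y.1) y.2 c := by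
  induction c using MvPolynomial.induction_on with
  | C a =>
    simp only [coe_eval₂Hom, eval₂_C]
    exact (MvPolynomial.continuous_eval a).comp continuous_fst
  | add p q hp hq => simp only [map_add]; exact hp.add hq
  | mul_X p i hp =>
    simp only [map_mul, eval₂Hom_X']
    exact hp.mul (by fun_prop)

theorem isGenericallyControlled_eval₂Hom (ι : Type*) (M : ℕ) :
    IsGenericallyControlled (fun _ : Fin M → ℂ => PUnit.unit.{1})
      fun (c : MvPolynomial (Fin M) (MvPolynomial ι ℂ)) t x => eval₂Hom (eval t) x c := by
  classical
  induction M with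
  | zero =>
    intro G
    set r : MvPolynomial (Fin 0) (MvPolynomial ι ℂ) → MvPolynomial ι ℂ := fun c => constantCoeff c
      with hr
    have hev : ∀ c (t : ι → ℂ) x, eval₂Hom (eval t) x c = eval t (r c) := fun c t x => by
      obtain ⟨a, rfl⟩ := C_surjective (Fin 0) c
      simp [hr]
    refine ⟨∏ c ∈ G.filter (r · ≠ 0), r c, Finset.prod_ne_zero_iff.mpr fun c hc =>
      (Finset.mem_filter.mp hc).2, fun t ht ε hε => ?_⟩
    rw [map_prod, Finset.prod_ne_zero_iff] at ht
    choose! V hV hV' using fun c (hc : c ∈ G.filter (r · ≠ 0)) =>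
      exists_nhds_relClose (MvPolynomial.continuous_eval (r c)) (ht c hc) hε
    refine ⟨⋂ c ∈ G.filter (r · ≠ 0), V c, (Filter.biInter_finset_mem _).mpr hV, fun γ hγ =>
      ⟨fun _ => Homeomorph.refl _, fun _ => Homeomorph.refl _, by simpa using continuous_snd,
        fun _ _ => rfl, ?_⟩⟩
    rintro _ ⟨c, hc, rfl⟩ x s u
    simp only [Set.mem_iInter] at hγ
    simp only [hev]
    by_cases h0 : r c = 0
    · simp [h0]
    · have hc' : c ∈ G.filter (r · ≠ 0) := Finset.mem_filter.mpr ⟨hc, h0⟩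
      exact (hV' c hc' _ (hγ s c hc')).2 _ (hγ u c hc')
  | succ M ih =>
    intro G
    set N := 2 + G.sup totalDegree with hN
    obtain ⟨s, hs, hs'⟩ := exists_isControlled_of_leadingCoeff
      (ev := fun t x => eval₂Hom (eval t) x) continuous_eval₂Hom_eval ih
      (G.image (nagataSubst (MvPolynomial ι ℂ) N M)) (fun c hc hc0 => by
        obtain ⟨c, hcG, rfl⟩ := Finset.mem_image.mp hc
        have h1 : c.totalDegree ≤ G.sup totalDegree := Finset.le_sup hcG
        obtain ⟨r, hr, hr'⟩ := exists_leadingCoeff_nagataSubst (N := N) (M := M) (by omega)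
          (fun h => hc0 (by rw [h, map_zero])) (by omega : c.totalDegree < N)
        exact ⟨r, hr, fun t x => by rw [hr']; simp⟩)
    refine ⟨s, hs, fun t ht => (hs' t ht).congr (nagataShear N M) ?_⟩
    rintro _ ⟨c, hc, rfl⟩
    refine ⟨nagataSubst _ N M c, Finset.mem_coe.mpr (Finset.mem_image_of_mem _ hc), ?_⟩
    funext t y
    exact eval_map_nagataSubst N M (eval t) c y.1 y.2

open Polynomial in
theorem exists_leadingCoeff_eq_rename {κ κ' k : Type*} [CommRing k] [IsDomain k]
    (ψ : MvPolynomial κ k →ₐ[k] (MvPolynomial κ' k)[X]) {τ : κ → κ'}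
    (hτ : Function.Injective τ) (hψ : ∀ i, (ψ (MvPolynomial.X i)).leadingCoeff = MvPolynomial.X (τ i))
    {p : MvPolynomial κ k} (hp : p ≠ 0) :
    ∃ r : MvPolynomial κ k, r ≠ 0 ∧ (ψ p).leadingCoeff = rename τ r := by
  classical
  set f : (κ →₀ ℕ) → (MvPolynomial κ' k)[X] := fun m => ψ (monomial m (coeff m p)) with hf
  have hlead : ∀ m a, (ψ (monomial m a)).leadingCoeff = rename τ (monomial m a) := fun m a => by
    rw [monomial_eq, Finsupp.prod, map_mul, map_mul, map_prod, map_prod, Polynomial.leadingCoeff_mul,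
      Polynomial.leadingCoeff_prod, ← MvPolynomial.algebraMap_eq, AlgHom.commutes,
      AlgHom.commutes, Polynomial.algebraMap_apply, Polynomial.leadingCoeff_C]
    simp [hψ]
  obtain ⟨m₀, hm₀, hmax⟩ := p.support.exists_max_image (fun m => (f m).natDegree)
    (support_nonempty.mpr hp)
  set e := (f m₀).natDegree with he
  set r := ∑ m ∈ p.support with (f m).natDegree = e, monomial m (coeff m p) with hr
  have hr0 : r ≠ 0 := fun h => by
    have h1 := congrArg (MvPolynomial.coeff m₀) h
    have hm₀' : m₀ ∈ p.support.filter fun m => (f m).natDegree = e :=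
      Finset.mem_filter.mpr ⟨hm₀, rfl⟩
    rw [hr, MvPolynomial.coeff_sum, Finset.sum_eq_single_of_mem m₀ hm₀'
      (fun m _ hm => by rw [MvPolynomial.coeff_monomial, if_neg hm]),
      MvPolynomial.coeff_monomial, if_pos rfl] at h1
    exact mem_support_iff.mp hm₀ h1
  have hsum : ψ p = ∑ m ∈ p.support, f m := by
    conv_lhs => rw [p.as_sum, map_sum]
  have hcoeff : (ψ p).coeff e = rename τ r := by
    rw [hsum, Polynomial.finsetSum_coeff, hr, map_sum, Finset.sum_filter]
    refine Finset.sum_congr rfl fun m hm => ?_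
    split_ifs with h
    · rw [← hlead, ← h]
      rfl
    · exact Polynomial.coeff_eq_zero_of_natDegree_lt (lt_of_le_of_ne (hmax m hm) h)
  have hne : rename τ r ≠ 0 := fun h => hr0 (rename_injective τ hτ (by rw [h, map_zero]))
  refine ⟨r, hr0, ?_⟩
  have hdeg : (ψ p).natDegree = e := by
    refine le_antisymm ?_ (Polynomial.le_natDegree_of_ne_zero (hcoeff ▸ hne))
    rw [hsum]
    exact Polynomial.natDegree_sum_le_of_forall_le _ _ hmax
  rw [Polynomial.leadingCoeff, hdeg, hcoeff]

/-- The coefficients of the polynomials in `j` variables obtained from polynomials of degree at most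
`d i` in `j + 1` variables, with coefficients `u`, by giving the value `z` to the first variable. -/
def sliceCoeff {M : ℕ} (d : Fin M → ℕ) {j : ℕ} (z : ℂ) (u : Fin M × (Fin (j + 1) → ℕ) → ℂ) :
    Fin M × (Fin j → ℕ) → ℂ := fun κ =>
  ∑ b ∈ Finset.range (d κ.1 - ∑ k, κ.2 k + 1), u (κ.1, Fin.cons b κ.2) * z ^ b

/-- The values of the polynomials of degree at most `d i` with coefficients `u`. -/
def evalCoeff {M : ℕ} (d : Fin M → ℕ) : ∀ {j : ℕ}, (Fin M × (Fin j → ℕ) → ℂ) → Fin M →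
    (Fin j → ℂ) → ℂ
  | 0, u, i, _ => u (i, 0)
  | _ + 1, u, i, v => evalCoeff d (sliceCoeff d (v 0) u) i (Fin.tail v)

open Polynomial in
/-- The ring homomorphism underlying `sliceCoeff`. -/
noncomputable def sliceHom {M : ℕ} (d : Fin M → ℕ) (j : ℕ) :
    MvPolynomial (Fin M × (Fin j → ℕ)) ℂ →ₐ[ℂ] (MvPolynomial (Fin M × (Fin (j + 1) → ℕ)) ℂ)[X] :=
  MvPolynomial.aeval fun κ => ∑ b ∈ Finset.range (d κ.1 - ∑ k, κ.2 k + 1),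
    Polynomial.C (MvPolynomial.X (κ.1, Fin.cons b κ.2)) * Polynomial.X ^ b

open Polynomial in
theorem eval_map_sliceHom {M : ℕ} (d : Fin M → ℕ) {j : ℕ} (p : MvPolynomial (Fin M × (Fin j → ℕ)) ℂ)
    (u : Fin M × (Fin (j + 1) → ℕ) → ℂ) (z : ℂ) :
    ((sliceHom d j p).map (MvPolynomial.eval u)).eval z =
      MvPolynomial.eval (sliceCoeff d z u) p := by
  have h : ((Polynomial.evalRingHom z).comp (Polynomial.mapRingHom (MvPolynomial.eval u))).comp
      (sliceHom d j : _ →+* (MvPolynomial (Fin M × (Fin (j + 1) → ℕ)) ℂ)[X]) =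
      MvPolynomial.eval (sliceCoeff d z u) := by
    refine MvPolynomial.ringHom_ext (fun r => ?_) fun i => ?_
    · simp [sliceHom, Polynomial.algebraMap_apply]
    · simp [sliceHom, sliceCoeff, Polynomial.eval_finsetSum, Polynomial.map_sum]
  exact RingHom.congr_fun h p

open Polynomial in
theorem leadingCoeff_sliceHom_X {M : ℕ} (d : Fin M → ℕ) {j : ℕ} (κ : Fin M × (Fin j → ℕ)) :
    (sliceHom d j (MvPolynomial.X κ)).leadingCoeff =
      MvPolynomial.X (κ.1, Fin.cons (d κ.1 - ∑ k, κ.2 k) κ.2) := by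
  set w := d κ.1 - ∑ k, κ.2 k with hw
  set p := sliceHom d j (MvPolynomial.X κ) with hp
  have hp' : p = ∑ b ∈ Finset.range (w + 1),
    Polynomial.C (MvPolynomial.X (κ.1, Fin.cons b κ.2)) * Polynomial.X ^ b := by
    rw [hp, sliceHom, MvPolynomial.aeval_X]
  have h1 : p.coeff w = MvPolynomial.X (κ.1, Fin.cons w κ.2) := by
    rw [hp', Polynomial.finsetSum_coeff]
    simp only [Polynomial.coeff_C_mul, Polynomial.coeff_X_pow]
    rw [Finset.sum_eq_single_of_mem w (by simp) fun b _ hb => by simp [hb.symm]]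
    simp
  have h2 : p.natDegree = w := by
    refine le_antisymm ?_ (Polynomial.le_natDegree_of_ne_zero (h1 ▸ MvPolynomial.X_ne_zero _))
    rw [hp']
    refine Polynomial.natDegree_sum_le_of_forall_le _ _ fun b hb => ?_
    exact (Polynomial.natDegree_C_mul_X_pow_le _ _).trans (Nat.lt_succ_iff.mp (Finset.mem_range.mp hb))
  rw [Polynomial.leadingCoeff, h2, h1]

theorem continuous_sliceCoeff {M : ℕ} (d : Fin M → ℕ) {j : ℕ} :
    Continuous fun y : ℂ × (Fin M × (Fin (j + 1) → ℕ) → ℂ) => sliceCoeff d y.1 y.2 := by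
  unfold sliceCoeff
  fun_prop

/-- The homeomorphism splitting off the first coordinate. -/
def prodConsHomeomorph (X : Type*) [TopologicalSpace X] (j : ℕ) :
    X × (Fin (j + 1) → ℂ) ≃ₜ (X × ℂ) × (Fin j → ℂ) where
  toFun y := ((y.1, y.2 0), Fin.tail y.2)
  invFun y := (y.1.1, Fin.cons y.1.2 y.2)
  left_inv y := by simp
  right_inv y := by simp
  continuous_toFun := by unfold Fin.tail; fun_prop
  continuous_invFun := by
    refine continuous_fst.fst.prodMk (continuous_pi fun i => ?_)
    refine Fin.cases ?_ (fun i => ?_) i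
    · simpa using continuous_fst.snd
    · simp only [Fin.cons_succ]; fun_prop

theorem exists_isControlled_evalCoeff.{u} {ι : Type*} {Y : Type*} [TopologicalSpace Y] {M : ℕ}
    (d : Fin M → ℕ) (j : ℕ) : ∀ (X : Type u) [TopologicalSpace X] (π : X → Y)
    (u : (ι → ℂ) → X → Fin M × (Fin j → ℕ) → ℂ)
    (_ : Continuous fun y : (ι → ℂ) × X => u y.1 y.2)
    (_ : IsGenericallyControlled π fun c t x => eval (u t x) c)
    (θ : Fin M × (Fin j → ℕ) → ι) (_ : Set.InjOn θ {κ | d κ.1 ≤ ∑ k, κ.2 k})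
    (_ : ∀ t x κ, d κ.1 ≤ ∑ k, κ.2 k → u t x κ = t (θ κ)),
    ∃ s : MvPolynomial ι ℂ, s ≠ 0 ∧ ∀ t, eval t s ≠ 0 →
      IsControlled (π ∘ Prod.fst : X × (Fin j → ℂ) → Y) t
        (Set.range fun i t y => evalCoeff d (u t y.1) i y.2) := by
  classical
  induction j with
  | zero =>
    intro X _ π u hu hctrl θ hθ htop
    obtain ⟨s, hs, hs'⟩ := hctrl (Finset.univ.image fun i => MvPolynomial.X (i, 0))
    refine ⟨s, hs, fun t ht => (hs' t ht).congr (Homeomorph.prodUnique X (Fin 0 → ℂ)) ?_⟩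
    rintro _ ⟨i, rfl⟩
    refine ⟨MvPolynomial.X (i, 0), by simp, ?_⟩
    funext t x
    simp [evalCoeff, Homeomorph.prodUnique]
  | succ j ih =>
    intro X _ π u hu hctrl θ hθ htop
    have hu' : Continuous fun y : (ι → ℂ) × X × ℂ => sliceCoeff d y.2.2 (u y.1 y.2.1) :=
      (continuous_sliceCoeff d).comp (f := fun y : (ι → ℂ) × X × ℂ => (y.2.2, u y.1 y.2.1))
        (continuous_snd.snd.prodMk (hu.comp (f := fun y : (ι → ℂ) × X × ℂ => (y.1, y.2.1))
          (by fun_prop)))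
    set τ : Fin M × (Fin j → ℕ) → Fin M × (Fin (j + 1) → ℕ) := fun κ =>
      (κ.1, Fin.cons (d κ.1 - ∑ k, κ.2 k) κ.2) with hτ
    have hτi : Function.Injective τ := fun κ κ' h => by
      simp only [hτ, Prod.mk.injEq, Fin.cons_inj] at h
      exact Prod.ext h.1 h.2.2
    have hτt : ∀ κ, d (τ κ).1 ≤ ∑ k, (τ κ).2 k := fun κ => by
      simp only [hτ, Fin.sum_univ_succ, Fin.cons_zero, Fin.cons_succ]
      omega
    obtain ⟨s, hs, hs'⟩ := ih (X × ℂ) (π ∘ Prod.fst) (fun t y => sliceCoeff d y.2 (u t y.1)) hu'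
      (fun G => by
        obtain ⟨s, hs, hs'⟩ := exists_isControlled_of_leadingCoeff (π := π)
          (ev := fun t x => eval (u t x))
          (fun a => (MvPolynomial.continuous_eval a).comp hu) hctrl (G.image (sliceHom d j))
          (fun c hc hc0 => by
            obtain ⟨p, hp, rfl⟩ := Finset.mem_image.mp hc
            obtain ⟨r, hr, hr'⟩ := exists_leadingCoeff_eq_rename (sliceHom d j) hτi
              (leadingCoeff_sliceHom_X d) (p := p) (fun h => hc0 (by rw [h, map_zero]))
            have hθτ : Function.Injective (θ ∘ τ) := fun κ κ' h =>
              hτi (hθ (hτt κ) (hτt κ') h)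
            refine ⟨rename (θ ∘ τ) r, fun h => hr (rename_injective _ hθτ (by rw [h, map_zero])),
              fun t x => ?_⟩
            rw [hr', eval_rename, eval_rename]
            congr 2
            funext κ
            exact htop t x _ (hτt κ))
        refine ⟨s, hs, fun t ht => (hs' t ht).mono ?_⟩
        rintro _ ⟨p, hp, rfl⟩
        refine ⟨sliceHom d j p, Finset.mem_coe.mpr (Finset.mem_image_of_mem _ hp), ?_⟩
        funext t y
        exact eval_map_sliceHom d p _ _)
      (fun κ => θ (κ.1, Fin.cons 0 κ.2))
      (fun κ hκ κ' hκ' h => by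
        have h1 := hθ (by simpa [Fin.sum_univ_succ] using hκ)
          (by simpa [Fin.sum_univ_succ] using hκ') h
        simp only [Prod.mk.injEq, Fin.cons_inj] at h1
        exact Prod.ext h1.1 h1.2.2)
      (fun t x κ hκ => by
        rw [← htop t x.1 _ (by simpa [Fin.sum_univ_succ] using hκ)]
        simp [sliceCoeff, Nat.sub_eq_zero_of_le hκ])
    refine ⟨s, hs, fun t ht => (hs' t ht).congr (prodConsHomeomorph X j) ?_⟩
    rintro _ ⟨i, rfl⟩
    refine ⟨i, ?_⟩
    funext t y
    simp [prodConsHomeomorph, evalCoeff]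

theorem IsControlled.id {X Y T : Type*} [TopologicalSpace X] [TopologicalSpace Y]
    [TopologicalSpace T] {π : X → Y} {t₀ : T} {G : Set (T → X → ℂ)} (h : IsControlled π t₀ G) :
    IsControlled (id : X → X) t₀ G := fun ε hε => by
  obtain ⟨N, hN, H⟩ := h ε hε
  refine ⟨N, hN, fun γ hγ => ?_⟩
  obtain ⟨h, g, h1, h2, h3⟩ := H γ hγ
  exact ⟨h, h, h1, fun _ _ => rfl, h3⟩

theorem evalCoeff_sub {M : ℕ} (d : Fin M → ℕ) (y : Fin M → ℂ) {j : ℕ}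
    (u : Fin M × (Fin j → ℕ) → ℂ) (i : Fin M) (v : Fin j → ℂ) :
    evalCoeff d (fun κ => u κ - if κ.2 = 0 then y κ.1 else 0) i v = evalCoeff d u i v - y i := by
  induction j with
  | zero => simp [evalCoeff]
  | succ j ih =>
    rw [evalCoeff, evalCoeff, ← ih]
    congr 1
    funext κ
    simp only [sliceCoeff, sub_mul, Finset.sum_sub_distrib]
    congr 1
    rw [Finset.sum_eq_single_of_mem 0 (by simp)]
    · have : (Fin.cons 0 κ.2 : Fin (j + 1) → ℕ) = 0 ↔ κ.2 = 0 := by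
        rw [funext_iff, funext_iff, Fin.forall_fin_succ]
        simp
      simp [this]
    · intro b _ hb
      have : (Fin.cons b κ.2 : Fin (j + 1) → ℕ) ≠ 0 := fun h => hb (by simpa using congrFun h 0)
      simp [this]

theorem continuous_evalCoeff {M : ℕ} (d : Fin M → ℕ) {j : ℕ} (i : Fin M) :
    Continuous fun y : (Fin M × (Fin j → ℕ) → ℂ) × (Fin j → ℂ) => evalCoeff d y.1 i y.2 := by
  induction j with
  | zero => simp only [evalCoeff]; fun_prop
  | succ j ih =>
    simp only [evalCoeff]
    refine ih.comp (f := fun y : (Fin M × (Fin (j + 1) → ℕ) → ℂ) × (Fin (j + 1) → ℂ) =>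
      (sliceCoeff d (y.2 0) y.1, Fin.tail y.2)) (Continuous.prodMk ?_ ?_)
    · exact (continuous_sliceCoeff d).comp
        (f := fun y : (Fin M × (Fin (j + 1) → ℕ) → ℂ) × (Fin (j + 1) → ℂ) => (y.2 0, y.1))
        (by fun_prop)
    · unfold Fin.tail; fun_prop

theorem evalCoeff_eq_eval {M : ℕ} (d : Fin M → ℕ) {j : ℕ} (u : Fin M × (Fin j → ℕ) → ℂ) (i : Fin M)
    (v : Fin j → ℂ) (P : MvPolynomial (Fin j) ℂ) (hP : ∀ m, d i < ∑ k, m k → coeff m P = 0)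
    (hu : ∀ m : Fin j →₀ ℕ, ∑ k, m k ≤ d i → u (i, m) = coeff m P) :
    evalCoeff d u i v = eval v P := by
  induction j with
  | zero =>
    obtain ⟨a, rfl⟩ := C_surjective (Fin 0) P
    have h := hu 0 (by simp)
    rw [coeff_zero_C] at h
    rw [evalCoeff, eval_C, ← h]
    rfl
  | succ j ih =>
    rw [evalCoeff]
    have hcoeff : ∀ m : Fin j →₀ ℕ, coeff m (Polynomial.eval (C (v 0)) (finSuccEquiv ℂ j P)) =
        ∑ b ∈ Finset.range (d i - ∑ k, m k + 1), coeff (m.cons b) P * v 0 ^ b := fun m => by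
      set B := max (d i) (finSuccEquiv ℂ j P).natDegree + 1
      rw [Polynomial.eval_eq_sum_range' (n := B) (by omega), coeff_sum]
      have h1 : ∀ b, coeff m ((finSuccEquiv ℂ j P).coeff b * C (v 0) ^ b) =
          coeff (m.cons b) P * v 0 ^ b := fun b => by
        rw [← C_pow, mul_comm, coeff_C_mul, finSuccEquiv_coeff_coeff, mul_comm]
      simp only [h1]
      refine (Finset.sum_subset (fun b hb => ?_) fun b _ hb => ?_).symm
      · rw [Finset.mem_range] at hb ⊢
        omega
      · rw [Finset.mem_range] at hb
        rw [hP, zero_mul]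
        simp only [Fin.sum_univ_succ, Finsupp.cons_zero, Finsupp.cons_succ]
        omega
    rw [ih _ (Fin.tail v) (Polynomial.eval (C (v 0)) (finSuccEquiv ℂ j P))]
    · conv_rhs => rw [← Fin.cons_self_tail v, eval_eq_eval_mv_eval', Polynomial.eval_map,
        Polynomial.eval₂_eq_eval_map]
      have h2 := Polynomial.hom_eval₂ (finSuccEquiv ℂ j P) (RingHom.id _) (eval (Fin.tail v)) (C (v 0))
      simpa [Polynomial.eval₂_eq_eval_map] using h2
    · intro m hm
      rw [hcoeff]
      refine Finset.sum_eq_zero fun b _ => ?_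
      rw [hP, zero_mul]
      simp only [Fin.sum_univ_succ, Finsupp.cons_zero, Finsupp.cons_succ]
      omega
    · intro m hm
      rw [hcoeff, sliceCoeff]
      refine Finset.sum_congr rfl fun b hb => ?_
      rw [Finset.mem_range] at hb
      dsimp only at hb ⊢
      rw [← hu]
      · rfl
      · simp only [Fin.sum_univ_succ, Finsupp.cons_zero, Finsupp.cons_succ]
        omega

theorem exists_isControlled_graph (n M : ℕ) (d : Fin M → ℕ) (hd : ∀ i, 0 < d i) :
    ∃ s : MvPolynomial (Fin M × (Fin n → ℕ)) ℂ, s ≠ 0 ∧ ∀ t, eval t s ≠ 0 →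
      IsControlled (Prod.fst : (Fin M → ℂ) × (Fin n → ℂ) → (Fin M → ℂ)) t
        (Set.range fun i t y => evalCoeff d t i y.2 - y.1 i) := by
  classical
  obtain ⟨s, hs, hs'⟩ := exists_isControlled_evalCoeff d n (Fin M → ℂ) id
    (fun (t : Fin M × (Fin n → ℕ) → ℂ) y κ => t κ - if κ.2 = 0 then y κ.1 else 0)
    (by
      refine continuous_pi fun κ => ?_
      split_ifs <;> fun_prop)
    (fun G => by
      set φ : MvPolynomial (Fin M × (Fin n → ℕ)) ℂ →ₐ[ℂ]
          MvPolynomial (Fin M) (MvPolynomial (Fin M × (Fin n → ℕ)) ℂ) :=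
        aeval fun κ => C (X κ) - if κ.2 = 0 then X κ.1 else 0 with hφ
      have hφe : ∀ c t x, eval₂Hom (eval t) x (φ c) =
          eval (fun κ => t κ - if κ.2 = 0 then x κ.1 else 0) c := fun c t x => by
        have : (eval₂Hom (eval t) x).comp (φ : _ →+* _) =
            eval (fun κ => t κ - if κ.2 = 0 then x κ.1 else 0) := by
          refine MvPolynomial.ringHom_ext (fun r => ?_) fun κ => ?_
          · simp [hφ, MvPolynomial.algebraMap_apply]
          · by_cases h : κ.2 = 0 <;> simp [hφ, h]
        exact RingHom.congr_fun this c
      obtain ⟨s, hs, hs'⟩ := isGenericallyControlled_eval₂Hom (Fin M × (Fin n → ℕ)) M (G.image φ)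
      refine ⟨s, hs, fun t ht => (hs' t ht).id.mono ?_⟩
      rintro _ ⟨c, hc, rfl⟩
      refine ⟨φ c, Finset.mem_coe.mpr (Finset.mem_image_of_mem _ hc), ?_⟩
      funext t x
      exact hφe c t x)
    id (Set.injOn_id _)
    (fun t y κ hκ => by
      have : κ.2 ≠ 0 := fun h => by
        have := hd κ.1
        simp [h] at hκ
        omega
      simp [this])
  refine ⟨s, hs, fun t ht => (hs' t ht).mono ?_⟩
  rintro _ ⟨i, rfl⟩
  refine ⟨i, ?_⟩
  funext t y
  exact evalCoeff_sub d y.1 t i y.2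

/-- A fibred homeomorphism matching the graphs of two maps makes these maps equivalent. -/
theorem exists_homeomorph_of_graph {X Y : Type*} [TopologicalSpace X] [TopologicalSpace Y]
    {f f' : X → Y} (hf : Continuous f) (hf' : Continuous f') (H : Y × X ≃ₜ Y × X) (g : Y ≃ₜ Y)
    (hg : ∀ p, (H p).1 = g p.1) (hH : ∀ p, p.1 = f p.2 ↔ (H p).1 = f' (H p).2) :
    ∃ Φ : X ≃ₜ X, ∀ x, g (f (Φ x)) = f' x := by
  have h1 : ∀ x, H (f x, x) = (f' (H (f x, x)).2, (H (f x, x)).2) := fun x =>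
    Prod.ext ((hH (f x, x)).mp rfl) rfl
  have h2 : ∀ x, H.symm (f' x, x) = (f (H.symm (f' x, x)).2, (H.symm (f' x, x)).2) := fun x =>
    Prod.ext ((hH (H.symm (f' x, x))).mpr (by simp)) rfl
  refine ⟨{ toFun := fun x => (H.symm (f' x, x)).2
            invFun := fun x => (H (f x, x)).2
            left_inv := fun x => by dsimp only; rw [← h2]; simp
            right_inv := fun x => by dsimp only; rw [← h1]; simp
            continuous_toFun := by fun_prop
            continuous_invFun := by fun_prop }, fun x => ?_⟩
  change g (f (H.symm (f' x, x)).2) = f' x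
  rw [← hg (f (H.symm (f' x, x)).2, (H.symm (f' x, x)).2), ← h2, H.apply_symm_apply]

/-- Topological equivalence of maps. -/
def TopEquiv {X Y : Type*} [TopologicalSpace X] [TopologicalSpace Y] (f f' : X → Y) : Prop :=
  ∃ (Φ : X ≃ₜ X) (Ψ : Y ≃ₜ Y), ∀ x, Ψ (f (Φ x)) = f' x

theorem TopEquiv.symm {X Y : Type*} [TopologicalSpace X] [TopologicalSpace Y] {f f' : X → Y}
    (h : TopEquiv f f') : TopEquiv f' f := by
  obtain ⟨Φ, Ψ, h⟩ := h
  exact ⟨Φ.symm, Ψ.symm, fun x => by rw [← h, Φ.apply_symm_apply, Ψ.symm_apply_apply]⟩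

theorem TopEquiv.trans {X Y : Type*} [TopologicalSpace X] [TopologicalSpace Y] {f f' f'' : X → Y}
    (h : TopEquiv f f') (h' : TopEquiv f' f'') : TopEquiv f f'' := by
  obtain ⟨Φ, Ψ, h⟩ := h
  obtain ⟨Φ', Ψ', h'⟩ := h'
  exact ⟨Φ'.trans Φ, Ψ.trans Ψ', fun x => by
    simp only [Homeomorph.trans_apply]
    rw [h, h']⟩

open unitInterval in
theorem IsControlled.exists_nhds_topEquiv {T X κ : Type*} [TopologicalSpace T] [TopologicalSpace X]
    {f : T → X → κ → ℂ} (hf : ∀ t, Continuous (f t)) {t₀ : T}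
    (h : IsControlled (Prod.fst : (κ → ℂ) × X → (κ → ℂ)) t₀
      (Set.range fun i t y => f t y.2 i - y.1 i)) :
    ∃ N ∈ nhds t₀, ∀ γ : C(I, T), (∀ s, γ s ∈ N) → TopEquiv (f (γ 0)) (f (γ 1)) := by
  obtain ⟨N, hN, H⟩ := h 1 one_pos
  refine ⟨N, hN, fun γ hγ => ?_⟩
  obtain ⟨h, g, -, hg, hrel⟩ := H γ hγ
  have hzero : ∀ s s' q, (h s q).1 = f (γ s) (h s q).2 → (h s' q).1 = f (γ s') (h s' q).2 := by
    intro s s' q hq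
    funext i
    have h1 := (hrel _ ⟨i, rfl⟩ q).eq_zero (t := s) (by simp [← hq]) s'
    exact (sub_eq_zero.mp h1).symm
  obtain ⟨Φ, hΦ⟩ := exists_homeomorph_of_graph (hf (γ 0)) (hf (γ 1)) ((h 0).symm.trans (h 1))
    ((g 0).symm.trans (g 1)) (fun p => by
      obtain ⟨q, rfl⟩ := (h 0).surjective p
      simp [hg]) (fun p => by
      obtain ⟨q, rfl⟩ := (h 0).surjective p
      simp only [Homeomorph.trans_apply, Homeomorph.symm_apply_apply]
      exact ⟨hzero 0 1 q, hzero 1 0 q⟩)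
  exact ⟨Φ, _, hΦ⟩

open unitInterval in
theorem topEquiv_of_locally {ι X Y : Type*} [TopologicalSpace X] [TopologicalSpace Y]
    {f : (ι → ℂ) → X → Y} {s : MvPolynomial ι ℂ}
    (h : ∀ t₀, eval t₀ s ≠ 0 →
      ∃ N ∈ nhds t₀, ∀ γ : C(I, ι → ℂ), (∀ s, γ s ∈ N) → TopEquiv (f (γ 0)) (f (γ 1)))
    {t t' : ι → ℂ} (ht : eval t s ≠ 0) (ht' : eval t' s ≠ 0) : TopEquiv (f t) (f t') := by
  set L : ℂ → ι → ℂ := fun z κ => t κ + z * (t' κ - t κ) with hL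
  have hLc : Continuous L := by fun_prop
  set p : Polynomial ℂ :=
    aeval (fun κ => Polynomial.C (t κ) + Polynomial.X * Polynomial.C (t' κ - t κ)) s with hp
  have hpL : ∀ z, p.eval z = eval (L z) s := fun z => by
    have : (Polynomial.evalRingHom z).comp ((aeval fun κ => Polynomial.C (t κ) +
        Polynomial.X * Polynomial.C (t' κ - t κ) : MvPolynomial ι ℂ →ₐ[ℂ] Polynomial ℂ) :
        MvPolynomial ι ℂ →+* Polynomial ℂ) = eval (L z) := by
      refine MvPolynomial.ringHom_ext (fun r => ?_) fun κ => ?_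
      · simp
      · simp [hL]
    exact RingHom.congr_fun this s
  have hL0 : L 0 = t := by simp [hL]
  have hL1 : L 1 = t' := by simp [hL]
  have hp0 : p ≠ 0 := fun h0 => ht (by rw [← hL0, ← hpL, h0, Polynomial.eval_zero])
  set V : Set ℂ := (p.rootSet ℂ)ᶜ with hV
  have hmem : ∀ z, z ∈ V ↔ eval (L z) s ≠ 0 := fun z => by
    rw [hV, Set.mem_compl_iff, Polynomial.mem_rootSet_of_ne hp0, Polynomial.coe_aeval_eq_eval, hpL]
  have hconn : IsPreconnected V :=
    ((p.rootSet_finite ℂ).countable.isPathConnected_compl_of_one_lt_rank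
      (by rw [Complex.rank_real_complex]; norm_num)).isConnected.isPreconnected
  rw [← hL0, ← hL1]
  refine hconn.induction₂ (fun z w => TopEquiv (f (L z)) (f (L w))) (fun z hz => ?_)
    (fun a b c _ _ _ h h' => h.trans h') (fun a b _ _ h => h.symm) ?_ ?_
  · obtain ⟨N, hN, hN'⟩ := h (L z) ((hmem z).mp hz)
    obtain ⟨r, hr, hr'⟩ := Metric.mem_nhds_iff.mp (hLc.continuousAt.preimage_mem_nhds hN)
    refine mem_nhdsWithin_of_mem_nhds (Filter.mem_of_superset (Metric.ball_mem_nhds z hr) ?_)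
    intro w hw
    have h1 := hN' ⟨fun a : I => L (z + (a : ℝ) * (w - z)), by fun_prop⟩ (fun a => hr' (by
      rw [Metric.mem_ball, dist_eq_norm] at hw ⊢
      rw [add_sub_cancel_left, norm_mul, Complex.norm_real, Real.norm_of_nonneg a.2.1]
      exact (mul_le_of_le_one_left (norm_nonneg _) a.2.2).trans_lt hw))
    simpa using h1
  · rw [hmem, hL0]; exact ht
  · rw [hmem, hL1]; exact ht'

/-- A homeomorphism acting by `Ψ` on some of the coordinates and by a translation on the others. -/
theorem exists_homeomorph_extend {ι κ : Type*} {p : ι → Prop} [DecidablePred p]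
    (e : κ ≃ {i // p i}) (Ψ : (κ → ℂ) ≃ₜ (κ → ℂ)) (b : ι → ℂ) :
    ∃ Ψ' : (ι → ℂ) ≃ₜ (ι → ℂ), ∀ y, (∀ k, Ψ' y (e k) = Ψ (fun k => y (e k)) k) ∧
      ∀ i, ¬ p i → Ψ' y i = y i + b i := by
  let F : ((κ → ℂ) ≃ₜ (κ → ℂ)) → (ι → ℂ) → (ι → ℂ) → ι → ℂ := fun Ψ b y i =>
    if h : p i then Ψ (fun k => y (e k)) (e.symm ⟨i, h⟩) else y i + b i
  have hFe : ∀ Ψ b y k, F Ψ b y (e k) = Ψ (fun k => y (e k)) k := fun Ψ b y k => by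
    simp [F, (e k).2]
  have hFp : ∀ Ψ b y i, ¬ p i → F Ψ b y i = y i + b i := fun Ψ b y i hi => by
    simp [F, hi]
  have hinv : ∀ Ψ b y, F Ψ.symm (-b) (F Ψ b y) = y := fun Ψ b y => by
    funext i
    by_cases hi : p i
    · obtain ⟨k, hk⟩ := e.surjective ⟨i, hi⟩
      obtain rfl : (e k : ι) = i := by rw [hk]
      simp only [hFe]
      simp
    · rw [hFp _ _ _ _ hi, hFp _ _ _ _ hi]
      simp
  have hcont : ∀ Ψ b, Continuous (F Ψ b) := fun Ψ b => by
    refine continuous_pi fun i => ?_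
    by_cases hi : p i
    · simp only [F, hi, dite_true]
      exact (continuous_apply _).comp (Ψ.continuous.comp (by fun_prop))
    · simp only [F, hi, dite_false]
      fun_prop
  exact ⟨{ toFun := F Ψ b
           invFun := F Ψ.symm (-b)
           left_inv := hinv Ψ b
           right_inv := fun y => by simpa using hinv Ψ.symm (-b) y
           continuous_toFun := hcont _ _
           continuous_invFun := hcont _ _ }, fun y => ⟨hFe Ψ b y, hFp Ψ b y⟩⟩

theorem exists_mvPolynomial_coeff_eq {k : Type*} [CommSemiring k] {n : ℕ} (d : ℕ)
    (a : (Fin n →₀ ℕ) → k) :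
    ∃ P : MvPolynomial (Fin n) k, ∀ m, coeff m P = if ∑ i, m i ≤ d then a m else 0 := by
  classical
  refine ⟨∑ m ∈ (Finset.range (d + 1)).biUnion (Finset.finsuppAntidiag Finset.univ),
    monomial m (a m), fun m => ?_⟩
  simp [coeff_sum, coeff_monomial, Finset.mem_finsuppAntidiag]

theorem sum_univ_le_totalDegree {k : Type*} [CommSemiring k] {n : ℕ} {P : MvPolynomial (Fin n) k}
    {m : Fin n →₀ ℕ} (hm : coeff m P ≠ 0) : ∑ i, m i ≤ P.totalDegree := by
  have := le_totalDegree (mem_support_iff.mpr hm)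
  rwa [Finsupp.sum_fintype _ _ fun _ => rfl] at this

theorem totalDegree_eq_of_coeff {k : Type*} [CommSemiring k] {n d : ℕ} {P : MvPolynomial (Fin n) k}
    (h : ∀ m, d < ∑ i, m i → coeff m P = 0) {m : Fin n →₀ ℕ} (hm : coeff m P ≠ 0)
    (hmd : ∑ i, m i = d) : P.totalDegree = d := by
  refine le_antisymm (Finset.sup_le fun v hv => ?_) (hmd ▸ sum_univ_le_totalDegree hm)
  rw [Finsupp.sum_fintype _ _ fun _ => rfl]
  by_contra! hlt
  exact mem_support_iff.mp hv (h v hlt)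

/-- For `n ≤ m` and a fixed multi-degree `(d₁, …, d_m)`, any two
general members of the family of polynomial mappings `ℂⁿ → ℂᵐ` of multi-degree
`(d₁, …, d_m)` are topologically equivalent: outside a proper Zariski closed subset of
the coefficient space, all members are topologically equivalent to one another. -/
theorem general_members_topEquiv (n m : ℕ) (hn : 0 < n) (hnm : n ≤ m)
    (d : Fin m → ℕ) :
    ∃ Z : Set (Fin m → MvPolynomial (Fin n) ℂ),
      -- `Z` is a Zariski closed subset of the coefficient space: the common zero locus
      -- of a set of polynomial functions of the coefficients
      (∃ S : Set ((Fin m → MvPolynomial (Fin n) ℂ) → ℂ),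
        (∀ φ ∈ S, φ ∈ Algebra.adjoin ℂ
          {ψ : (Fin m → MvPolynomial (Fin n) ℂ) → ℂ |
            ∃ (i : Fin m) (s : Fin n →₀ ℕ), ψ = fun P => coeff s (P i)}) ∧
        Z = {P | ∀ φ ∈ S, φ P = 0}) ∧
      -- `Z` is a proper subset of the family of maps of multi-degree `d`
      ¬ {P : Fin m → MvPolynomial (Fin n) ℂ | ∀ i, (P i).totalDegree = d i} ⊆ Z ∧
      -- all members outside `Z` are topologically equivalent
      (∀ P P' : Fin m → MvPolynomial (Fin n) ℂ,
        (∀ i, (P i).totalDegree = d i) → (∀ i, (P' i).totalDegree = d i) →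
        P ∉ Z → P' ∉ Z →
        ∃ (Φ : (Fin n → ℂ) ≃ₜ (Fin n → ℂ)) (Ψ : (Fin m → ℂ) ≃ₜ (Fin m → ℂ)),
          ∀ x, Ψ (fun i => eval (Φ x) (P i)) = fun i => eval x (P' i)) := by
  classical
  set e : Fin (Fintype.card {i // 0 < d i}) ≃ {i // 0 < d i} := (Fintype.equivFin _).symm
  set M := Fintype.card {i // 0 < d i}
  set d' : Fin M → ℕ := fun k => d (e k) with hd'
  obtain ⟨s, hs, hs'⟩ := exists_isControlled_graph n M d' fun k => (e k).2
  have heq : ∀ t t', eval t s ≠ 0 → eval t' s ≠ 0 →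
      TopEquiv (fun v i => evalCoeff d' t i v) (fun v i => evalCoeff d' t' i v) :=
    fun t t' ht ht' => topEquiv_of_locally (f := fun t v i => evalCoeff d' t i v) (fun t₀ h₀ =>
      (hs' t₀ h₀).exists_nhds_topEquiv (f := fun t v i => evalCoeff d' t i v) fun t =>
        continuous_pi fun i => (continuous_evalCoeff d' i).comp
          (f := fun v : Fin n → ℂ => (t, v)) (by fun_prop)) ht ht'
  -- a general point with nonvanishing coefficients of top degree
  set top : Fin M → Fin M × (Fin n → ℕ) := fun k => (k, Pi.single ⟨0, hn⟩ (d' k)) with htop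
  obtain ⟨t, ht⟩ : ∃ t, eval t (s * ∏ k, X (top k)) ≠ 0 := by
    by_contra! h
    exact mul_ne_zero hs (Finset.prod_ne_zero_iff.mpr fun k _ => X_ne_zero (top k))
      (MvPolynomial.funext fun t => by rw [h, map_zero])
  rw [map_mul, map_prod, mul_ne_zero_iff, Finset.prod_ne_zero_iff] at ht
  simp only [Finset.mem_univ, true_implies, eval_X] at ht
  set c : (Fin m → MvPolynomial (Fin n) ℂ) → Fin M × (Fin n → ℕ) → ℂ := fun P κ =>
    if ∑ i, κ.2 i ≤ d' κ.1 then coeff (Finsupp.equivFunOnFinite.symm κ.2) (P (e κ.1)) else t κ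
    with hc
  have hceval : ∀ P : Fin m → MvPolynomial (Fin n) ℂ, (∀ i, (P i).totalDegree = d i) → ∀ k v,
      evalCoeff d' (c P) k v = eval v (P (e k)) := fun P hP k v => by
    refine evalCoeff_eq_eval d' (c P) k v _ (fun a ha => ?_) fun a ha => ?_
    · by_contra h
      have := sum_univ_le_totalDegree h
      rw [hP] at this
      exact absurd ha (not_lt.mpr this)
    · simp only [hc, ha, if_true]
      congr 1
      ext; rfl
  refine ⟨{P | eval (c P) s = 0}, ⟨{fun P => eval (c P) s}, ?_, by simp⟩, ?_, ?_⟩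
  · rintro _ rfl
    clear hs hs' heq ht
    induction s using MvPolynomial.induction_on with
    | C a =>
      simp only [eval_C]
      exact Subalgebra.algebraMap_mem _ a
    | add p q hp hq =>
      simp only [map_add]
      exact Subalgebra.add_mem _ hp hq
    | mul_X p κ hp =>
      simp only [map_mul, eval_X]
      refine Subalgebra.mul_mem _ hp ?_
      by_cases hκ : ∑ i, κ.2 i ≤ d' κ.1
      · simp only [hc, hκ, if_true]
        exact Algebra.subset_adjoin ⟨_, _, rfl⟩
      · simp only [hc, hκ, if_false]
        exact Subalgebra.algebraMap_mem _ (t κ)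
  · choose Q hQ using fun k => exists_mvPolynomial_coeff_eq (d' k) fun a : Fin n →₀ ℕ => t (k, a)
    have hQd : ∀ k, (Q k).totalDegree = d' k := fun k => by
      refine totalDegree_eq_of_coeff (m := Finsupp.single ⟨0, hn⟩ (d' k)) (fun a ha => ?_) ?_ ?_
      · rw [hQ, if_neg (not_le.mpr ha)]
      · have h := ht.2 k
        rw [hQ, if_pos (by simp [Finsupp.single_apply]), Finsupp.single_eq_pi_single]
        exact h
      · simp [Finsupp.single_apply]
    intro hsub
    set P : Fin m → MvPolynomial (Fin n) ℂ := fun i =>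
      if h : 0 < d i then Q (e.symm ⟨i, h⟩) else 0 with hP
    have hPe : ∀ k, P (e k) = Q k := fun k => by simp [hP, (e k).2]
    have hmem : ∀ i, (P i).totalDegree = d i := fun i => by
      by_cases hi : 0 < d i
      · obtain ⟨k, hk⟩ := e.surjective ⟨i, hi⟩
        obtain rfl : (e k : Fin m) = i := by rw [hk]
        rw [hPe, hQd]
      · simp only [hP, hi, dite_false, totalDegree_zero]
        omega
    have hcP : c P = t := by
      funext κ
      simp only [hc, hPe, hQ]
      split_ifs with h1 h2
      · rfl
      · exact absurd h1 h2
      · rfl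
    exact ht.1 (by simpa only [Set.mem_ofPred_eq, hcP] using hsub hmem)
  · intro P P' hP hP' hPZ hPZ'
    obtain ⟨Φ, Ψ, h⟩ := heq (c P) (c P') hPZ hPZ'
    have hconst : ∀ Q : Fin m → MvPolynomial (Fin n) ℂ, (∀ i, (Q i).totalDegree = d i) → ∀ i,
        ¬ 0 < d i → ∀ x, eval x (Q i) = coeff 0 (Q i) := fun Q hQ i hi x => by
      have h1 := totalDegree_eq_zero_iff_eq_C.mp ((hQ i).trans (by omega))
      conv_lhs => rw [h1, eval_C]
    obtain ⟨Ψ', hΨ'⟩ := exists_homeomorph_extend e Ψ fun i => coeff 0 (P' i) - coeff 0 (P i)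
    refine ⟨Φ, Ψ', fun x => ?_⟩
    funext i
    obtain ⟨h1, h2⟩ := hΨ' fun i => eval (Φ x) (P i)
    by_cases hi : 0 < d i
    · obtain ⟨k, hk⟩ := e.surjective ⟨i, hi⟩
      obtain rfl : (e k : Fin m) = i := by rw [hk]
      rw [h1, ← hceval P' hP']
      have h3 := congrFun (h x) k
      simp only [hceval P hP] at h3
      exact h3
    · rw [h2 i hi, hconst P hP i hi, hconst P' hP' i hi]
      ring
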